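/- Let D ⊇ G ⊇ H be rooted digraphs with root r and let v ∈ V−r. Suppose there is an edge uw ∈ D∖G with u ∉ B_{v,H} and w ∈ int_{H−rv}(B_{v,H}), and suppose ent_{H−rv}(B_{v,H}) = ent_{G−rv}(B_{v,H}). Then for every I ∈ G_G(w) one has I ∪ {uw} ∈ G_{G+uw}(w). -/

import Mathlib

namespace FlamePaper

universe u
variable {V : Type u}

/-- A (nonempty, repetition-free) directed path, given by the list of its vertices;
its edge set consists of the pairs of consecutive vertices. A one-vertex list is the
trivial `v→v` path. -/
structure DiPath (V : Type u) where
  verts : List V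
  ne : verts ≠ []
  nodup : verts.Nodup

namespace DiPath
variable (P : DiPath V)
def first : V := P.verts.head P.ne
def last : V := P.verts.getLast P.ne
def vertexSet : Set V := {x | x ∈ P.verts}
def edges : Set (V × V) := {e | e ∈ P.verts.zip P.verts.tail}
def internal : Set V := P.vertexSet \ {P.first, P.last}
/-- The last edge of `P` (as a set; empty for the trivial path). -/
def lastEdge : Set (V × V) := {e ∈ P.edges | e.2 = P.last}
end DiPath

/-- `P` is a path of the digraph `D`. -/
def IsPathIn (D : Set (V × V)) (P : DiPath V) : Prop := P.edges ⊆ D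

/-- `P` is an `a→b` path in `D`. -/
def IsPath (D : Set (V × V)) (a b : V) (P : DiPath V) : Prop :=
  IsPathIn D P ∧ P.first = a ∧ P.last = b

/-- The set of ingoing edges of `v` in `D`. -/
def inEdges (D : Set (V × V)) (v : V) : Set (V × V) := {e ∈ D | e.2 = v}

/-- The set of outgoing edges of `v` in `D`. -/
def outEdges (D : Set (V × V)) (v : V) : Set (V × V) := {e ∈ D | e.1 = v}

/-- A rooted digraph: the root has no ingoing edges. -/
def IsRooted (D : Set (V × V)) (r : V) : Prop := inEdges D r = ∅

/-- `Ps` is a system of internally disjoint `r→v` paths in `D`: any two distinct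
members share exactly the vertices `r` and `v`. -/
def IntDisjSystem (D : Set (V × V)) (r v : V) (Ps : Set (DiPath V)) : Prop :=
  (∀ P ∈ Ps, IsPath D r v P) ∧
  ∀ P ∈ Ps, ∀ Q ∈ Ps, P ≠ Q → P.vertexSet ∩ Q.vertexSet = {r, v}

/-- `A_last(Ps)`: the set of last edges of the paths in `Ps`. -/
def lastEdges (Ps : Set (DiPath V)) : Set (V × V) := ⋃ P ∈ Ps, P.lastEdge

/-- `𝒢_D(v)`: the set of those `I ⊆ in_D(v)` which arise as the set of last edges
of a system of internally disjoint `r→v` paths of `D`. -/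
def GSet (D : Set (V × V)) (r v : V) : Set (Set (V × V)) :=
  {I | ∃ Ps, IntDisjSystem D r v Ps ∧ lastEdges Ps = I}

/-- `Ps ∈ ℑ_D(v)`: an internally disjoint system of `r→v` paths of `D` from each member
of which one can choose either an internal vertex or an edge so that the resulting set
meets every `r→v` path of `D`. -/
def EMSystem (D : Set (V × V)) (r v : V) (Ps : Set (DiPath V)) : Prop :=
  IntDisjSystem D r v Ps ∧
  ∃ sel : DiPath V → V ⊕ (V × V),
    (∀ P ∈ Ps, (∀ x, sel P = Sum.inl x → x ∈ P.internal) ∧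
              (∀ e, sel P = Sum.inr e → e ∈ P.edges)) ∧
    ∀ Q : DiPath V, IsPath D r v Q →
      ∃ P ∈ Ps, (∀ x, sel P = Sum.inl x → x ∈ Q.vertexSet) ∧
               (∀ e, sel P = Sum.inr e → e ∈ Q.edges)

/-- The path-system `Ps` lies in `L`. -/
def LiesIn (Ps : Set (DiPath V)) (L : Set (V × V)) : Prop := ∀ P ∈ Ps, IsPathIn L P

/-- `L` is a `D`-vertex-large spanning subdigraph of `D`. -/
def IsLarge (D L : Set (V × V)) (r : V) : Prop :=
  L ⊆ D ∧ ∀ v, v ≠ r → ∃ Ps, EMSystem D r v Ps ∧ LiesIn Ps L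

/-- `F` is a vertex-flame with root `r`. -/
def IsFlame (F : Set (V × V)) (r : V) : Prop :=
  ∀ v, v ≠ r → inEdges F v ∈ GSet F r v

/-- `F` is a quasi-vertex-flame with root `r`. -/
def IsQuasiFlame (F : Set (V × V)) (r : V) : Prop :=
  ∀ v, v ≠ r → ∀ I ⊆ inEdges F v, I.Finite → I ∈ GSet F r v

/-- `S` separates `b` from `a` in `D`: every `a→b` path of `D` meets `S`. -/
def Separates (D : Set (V × V)) (a b : V) (S : Set V) : Prop :=
  ∀ P : DiPath V, IsPath D a b P → (P.vertexSet ∩ S).Nonempty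

/-- `𝔖_D(v)`: the Erdős–Menger separations corresponding to `v`. -/
def SepSet (D : Set (V × V)) (r v : V) : Set (Set V) :=
  {S | r ∉ S ∧ v ∉ S ∧ Separates (D \ {(r, v)}) r v S ∧
    ∃ Ps, IntDisjSystem D r v Ps ∧
      ∃ sel : DiPath V → V, (∀ P ∈ Ps, sel P ∈ P.internal) ∧ S = sel '' Ps}

/-- The entrance of `X` with respect to `D`. -/
def entrance (D : Set (V × V)) (X : Set V) : Set V :=
  {v ∈ X | ∃ u, u ∉ X ∧ (u, v) ∈ D}

/-- `int_D(X) = X ∖ ent_D(X)`. -/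
def interiorSet (D : Set (V × V)) (X : Set V) : Set V := X \ entrance D X

/-- `B` is a `v`-bubble of `D` (with root `r`): `B ⊆ V − r` and there is a `v`-infan
`{P_u : u ∈ ent_D(B)}` in `D ∩ (B × B)` where `P_u` starts at `u`. -/
def IsBubble (D : Set (V × V)) (r v : V) (B : Set V) : Prop :=
  r ∉ B ∧
  ∃ F : V → DiPath V,
    (∀ u ∈ entrance D B, IsPath (D ∩ B ×ˢ B) u v (F u)) ∧
    ∀ u ∈ entrance D B, ∀ u' ∈ entrance D B, u ≠ u' →
      (F u).vertexSet ∩ (F u').vertexSet = {v}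

/-- `bubb_D(v)`. -/
def bubbles (D : Set (V × V)) (r v : V) : Set (Set V) := {B | IsBubble D r v B}

/-- `B_{v,D}`: the union of all `v`-bubbles of `D`. -/
def maxBubble (D : Set (V × V)) (r v : V) : Set V := ⋃₀ bubbles D r v

/-- `B_{S,v,D}`: the set of vertices `u` such that every `r→u` path of `D−rv` meets `S`. -/
def Bset (D : Set (V × V)) (r v : V) (S : Set V) : Set V :=
  {u | ∀ P : DiPath V, IsPath (D \ {(r, v)}) r u P → (P.vertexSet ∩ S).Nonempty}

/-- `Ps` is an `r`-fan in `D`: paths of `D` starting at `r`, any two distinct members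
having only the vertex `r` in common. -/
def IsRFan (D : Set (V × V)) (r : V) (Ps : Set (DiPath V)) : Prop :=
  (∀ P ∈ Ps, IsPathIn D P ∧ P.first = r) ∧
  ∀ P ∈ Ps, ∀ Q ∈ Ps, P ≠ Q → P.vertexSet ∩ Q.vertexSet = {r}

/-- The set of first vertices of the paths in `Ps`. -/
def Vfirst (Ps : Set (DiPath V)) : Set V := DiPath.first '' Ps

/-- The set of last vertices of the paths in `Ps`. -/
def Vlast (Ps : Set (DiPath V)) : Set V := DiPath.last '' Ps

/-- `P` is an `X→Y` path in `D`: exactly its first vertex lies in `X` and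
exactly its last vertex lies in `Y`. -/
def IsXYPath (D : Set (V × V)) (X Y : Set V) (P : DiPath V) : Prop :=
  IsPathIn D P ∧ P.vertexSet ∩ X = {P.first} ∧ P.vertexSet ∩ Y = {P.last}

/-- `Ps` is a system of pairwise (vertex-)disjoint `X→Y` paths of `D`. -/
def DisjXYSystem (D : Set (V × V)) (X Y : Set V) (Ps : Set (DiPath V)) : Prop :=
  (∀ P ∈ Ps, IsXYPath D X Y P) ∧
  ∀ P ∈ Ps, ∀ Q ∈ Ps, P ≠ Q → P.vertexSet ∩ Q.vertexSet = ∅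

/-- `κ_D(r,v)`: the maximum size of a (finite) system of internally disjoint `r→v`
paths of `D`. -/
noncomputable def kappa (D : Set (V × V)) (r v : V) : ℕ :=
  sSup {n : ℕ | ∃ Ps : Set (DiPath V), IntDisjSystem D r v Ps ∧ Ps.Finite ∧ Ps.ncard = n}

section

/-- The digraph obtained from `D` by deleting the vertices in `K`. -/
def del (D : Set (V × V)) (K : Set V) : Set (V × V) := {e ∈ D | e.1 ∉ K ∧ e.2 ∉ K}

/-- `σ` is a successor function on `Z` describing a family of disjoint paths inside `Z`, all of
them ending in `T` or not at all needed; no vertex of `X` is a successor, so every vertex of `X`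
starts a path, and by `fin` this path reaches `T` after finitely many steps. -/
structure Linkage (D : Set (V × V)) (Z T X : Set V) (σ : V → V) : Prop where
  maps : ∀ z ∈ Z, z ∉ T → σ z ∈ Z
  edge : ∀ z ∈ Z, z ∉ T → σ z = z ∨ (z, σ z) ∈ D
  avoid : ∀ z ∈ Z, z ∉ T → σ z ∉ X
  inj : ∀ z ∈ Z, z ∉ T → ∀ z' ∈ Z, z' ∉ T → σ z = σ z' → z = z'
  fin : ∀ z ∈ Z, ∃ F : Set V, F.Finite ∧ z ∈ F ∧ F ⊆ Z ∧ ∀ w ∈ F, w ∉ T → σ w ∈ F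

namespace Linkage

variable {D : Set (V × V)} {Z T X : Set V} {σ : V → V}

theorem mono_target {T' : Set V} (h : Linkage D Z T X σ) (hT : T ⊆ T') : Linkage D Z T' X σ where
  maps z hz hzT := h.maps z hz fun hh => hzT (hT hh)
  edge z hz hzT := h.edge z hz fun hh => hzT (hT hh)
  avoid z hz hzT := h.avoid z hz fun hh => hzT (hT hh)
  inj z hz hzT z' hz' hzT' := h.inj z hz (fun hh => hzT (hT hh)) z' hz' fun hh => hzT' (hT hh)
  fin z hz := by
    obtain ⟨F, h1, h2, h3, h4⟩ := h.fin z hz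
    exact ⟨F, h1, h2, h3, fun w hw hwT => h4 w hw fun hh => hwT (hT hh)⟩

/-- Only the part of the target set inside `Z` matters. -/
theorem mono_target_of_inter {T' : Set V} (h : Linkage D Z T X σ) (hT : T ∩ Z ⊆ T') :
    Linkage D Z T' X σ where
  maps z hz hzT := h.maps z hz fun hh => hzT (hT ⟨hh, hz⟩)
  edge z hz hzT := h.edge z hz fun hh => hzT (hT ⟨hh, hz⟩)
  avoid z hz hzT := h.avoid z hz fun hh => hzT (hT ⟨hh, hz⟩)
  inj z hz hzT z' hz' hzT' :=
    h.inj z hz (fun hh => hzT (hT ⟨hh, hz⟩)) z' hz' fun hh => hzT' (hT ⟨hh, hz'⟩)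
  fin z hz := by
    obtain ⟨F, h1, h2, h3, h4⟩ := h.fin z hz
    exact ⟨F, h1, h2, h3, fun w hw hwT => h4 w hw fun hh => hwT (hT ⟨hh, h3 hw⟩)⟩

theorem graph {D' : Set (V × V)} (h : Linkage D Z T X σ)
    (hD : ∀ z ∈ Z, z ∉ T → (z, σ z) ∈ D → (z, σ z) ∈ D') : Linkage D' Z T X σ where
  maps := h.maps
  edge z hz hzT := (h.edge z hz hzT).imp id (hD z hz hzT)
  avoid := h.avoid
  inj := h.inj
  fin := h.fin

theorem avoid_of {X' : Set V} (h : Linkage D Z T X σ) (hX : ∀ x ∈ X', x ∈ Z → x ∈ X) :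
    Linkage D Z T X' σ where
  maps := h.maps
  edge := h.edge
  avoid z hz hzT hh := h.avoid z hz hzT (hX _ hh (h.maps z hz hzT))
  inj := h.inj
  fin := h.fin

theorem mem_iter (h : Linkage D Z T X σ) {e : V} (he : e ∈ Z) :
    ∀ n, (∀ j < n, σ^[j] e ∉ T) → σ^[n] e ∈ Z := by
  intro n
  induction n with
  | zero => intro _; exact he
  | succ n ih =>
    intro hb
    rw [Function.iterate_succ_apply']
    exact h.maps _ (ih fun j hj => hb j (by omega)) (hb n (by omega))

theorem orbit_unique (h : Linkage D Z T X σ) {e e' : V} (he : e ∈ Z) (he' : e' ∈ Z)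
    (hr : ∀ z ∈ Z, z ∉ T → σ z ≠ e) (hr' : ∀ z ∈ Z, z ∉ T → σ z ≠ e') :
    ∀ i j, (∀ k < i, σ^[k] e ∉ T) → (∀ k < j, σ^[k] e' ∉ T) → σ^[i] e = σ^[j] e' →
      i = j ∧ e = e' := by
  intro i
  induction i with
  | zero =>
    intro j _ hj hij
    cases j with
    | zero => exact ⟨rfl, hij⟩
    | succ j =>
      rw [Function.iterate_succ_apply'] at hij
      exact absurd hij.symm (hr _ (h.mem_iter he' j fun k hk => hj k (by omega)) (hj j (by omega)))
  | succ i ih =>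
    intro j hi hj hij
    cases j with
    | zero =>
      rw [Function.iterate_succ_apply'] at hij
      exact absurd hij (hr' _ (h.mem_iter he i fun k hk => hi k (by omega)) (hi i (by omega)))
    | succ j =>
      rw [Function.iterate_succ_apply', Function.iterate_succ_apply'] at hij
      have := h.inj _ (h.mem_iter he i fun k hk => hi k (by omega)) (hi i (by omega))
        _ (h.mem_iter he' j fun k hk => hj k (by omega)) (hj j (by omega)) hij
      have := ih j (fun k hk => hi k (by omega)) (fun k hk => hj k (by omega)) this
      exact ⟨by rw [this.1], this.2⟩

theorem reach (h : Linkage D Z T X σ) {e : V} (he : e ∈ Z) (hr : ∀ z ∈ Z, z ∉ T → σ z ≠ e) :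
    ∃ n, σ^[n] e ∈ T ∧ ∀ j < n, σ^[j] e ∉ T := by
  by_cases hex : ∃ n, σ^[n] e ∈ T
  · classical
    exact ⟨Nat.find hex, Nat.find_spec hex, fun j hj => Nat.find_min hex hj⟩
  · exfalso
    push Not at hex
    obtain ⟨F, hF, heF, hFZ, hcl⟩ := h.fin e he
    have hmem : ∀ n, σ^[n] e ∈ F := by
      intro n
      induction n with
      | zero => exact heF
      | succ n ih => rw [Function.iterate_succ_apply']; exact hcl _ ih (hex n)
    have hinj : Function.Injective fun n => σ^[n] e := fun i j hij =>
      (h.orbit_unique he he hr hr i j (fun k _ => hex k) (fun k _ => hex k) hij).1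
    exact Set.infinite_range_of_injective hinj
      (hF.subset (by rintro _ ⟨n, rfl⟩; exact hmem n))

open Classical in
theorem comb {Z2 : Set V} {σ2 : V → V} (h : Linkage D Z T X σ)
    (h2 : Linkage D Z2 (T ∪ Z) X σ2)
    (hc : ∀ z ∈ Z, z ∉ T → ∀ z' ∈ Z2, z' ∉ Z → z' ∉ T → σ z ≠ σ2 z') :
    Linkage D (Z ∪ Z2) T X (fun z => if z ∈ Z then σ z else σ2 z) where
  maps z hz hzT := by
    by_cases hZ : z ∈ Z
    · simp only [hZ, if_true]; exact Or.inl (h.maps z hZ hzT)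
    · simp only [hZ, if_false]
      exact Or.inr (h2.maps z (hz.resolve_left hZ) (by simp [hZ, hzT]))
  edge z hz hzT := by
    by_cases hZ : z ∈ Z
    · simp only [hZ, if_true]; exact h.edge z hZ hzT
    · simp only [hZ, if_false]
      exact h2.edge z (hz.resolve_left hZ) (by simp [hZ, hzT])
  avoid z hz hzT := by
    by_cases hZ : z ∈ Z
    · simp only [hZ, if_true]; exact h.avoid z hZ hzT
    · simp only [hZ, if_false]
      exact h2.avoid z (hz.resolve_left hZ) (by simp [hZ, hzT])
  inj z hz hzT z' hz' hzT' he := by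
    by_cases hZ : z ∈ Z <;> by_cases hZ' : z' ∈ Z <;> simp only [hZ, hZ', if_true, if_false] at he
    · exact h.inj z hZ hzT z' hZ' hzT' he
    · exact absurd he (hc z hZ hzT z' (hz'.resolve_left hZ') hZ' hzT')
    · exact absurd he.symm (hc z' hZ' hzT' z (hz.resolve_left hZ) hZ hzT)
    · exact h2.inj z (hz.resolve_left hZ) (by simp [hZ, hzT]) z' (hz'.resolve_left hZ')
        (by simp [hZ', hzT']) he
  fin z hz := by
    by_cases hZ : z ∈ Z
    · obtain ⟨F, h1, h2, h3, h4⟩ := h.fin z hZ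
      refine ⟨F, h1, h2, fun w hw => Or.inl (h3 hw), fun w hw hwT => ?_⟩
      simp only [h3 hw, if_true]; exact h4 w hw hwT
    · obtain ⟨F, f1, f2, f3, f4⟩ := h2.fin z (hz.resolve_left hZ)
      choose! f g1 g2 g3 g4 using h.fin
      refine ⟨F ∪ ⋃ w ∈ F ∩ Z, f w, f1.union ((f1.subset Set.inter_subset_left).biUnion
        fun w hw => g1 w hw.2), Or.inl f2, ?_, ?_⟩
      · rintro w (hw | hw)
        · exact Or.inr (f3 hw)
        · simp only [Set.mem_iUnion] at hw
          obtain ⟨a, ha, hw⟩ := hw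
          exact Or.inl (g3 a ha.2 hw)
      · intro w hw hwT
        by_cases hwZ : w ∈ Z
        · simp only [hwZ, if_true]
          have : ∃ a ∈ F ∩ Z, w ∈ f a := by
            rcases hw with hw | hw
            · exact ⟨w, ⟨hw, hwZ⟩, g2 w hwZ⟩
            · simpa only [Set.mem_iUnion, exists_prop] using hw
          obtain ⟨a, ha, hwa⟩ := this
          exact Or.inr (Set.mem_biUnion ha (g4 a ha.2 w hwa hwT))
        · simp only [hwZ, if_false]
          have hwF : w ∈ F := by
            rcases hw with hw | hw
            · exact hw
            · simp only [Set.mem_iUnion] at hw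
              obtain ⟨a, ha, hw⟩ := hw
              exact absurd (g3 a ha.2 hw) hwZ
          exact Or.inl (f4 w hwF (by simp [hwT, hwZ]))

theorem iUnion {ι : Type*} [LinearOrder ι] [WellFoundedLT ι] {W : ι → Set V} {s : ι → V → V}
    (h : ∀ i, Linkage D (W i) T X (s i))
    (hc : ∀ i j, i < j → ∀ z ∈ W i, z ∉ T → ∀ z' ∈ W j, z' ∉ W i → z' ∉ T → s i z ≠ s j z') :
    ∃ τ, Linkage D (⋃ i, W i) T X τ := by
  classical
  have hmin : ∀ z ∈ ⋃ i, W i, ∃ i, z ∈ W i ∧ ∀ j < i, z ∉ W j := by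
    intro z hz
    obtain ⟨i, hi⟩ := Set.mem_iUnion.1 hz
    have hne : {i | z ∈ W i}.Nonempty := ⟨i, hi⟩
    exact ⟨wellFounded_lt.min {i | z ∈ W i} hne, wellFounded_lt.min_mem _ hne,
      fun j hj hz => wellFounded_lt.not_lt_min {i | z ∈ W i} hz hj⟩
  rcases isEmpty_or_nonempty ι with hι | hι
  · refine ⟨id, ?_, ?_, ?_, ?_, ?_⟩ <;> simp
  choose! m hm1 hm2 using hmin
  have hmle : ∀ i, ∀ z ∈ W i, m z ≤ i := fun i z hz => by
    by_contra hlt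
    exact hm2 z (Set.mem_iUnion.2 ⟨i, hz⟩) i (not_le.1 hlt) hz
  refine ⟨fun z => s (m z) z, ?_, ?_, ?_, ?_, ?_⟩
  · exact fun z hz hzT => Set.mem_iUnion.2 ⟨m z, (h _).maps z (hm1 z hz) hzT⟩
  · exact fun z hz hzT => (h _).edge z (hm1 z hz) hzT
  · exact fun z hz hzT => (h _).avoid z (hm1 z hz) hzT
  · intro z hz hzT z' hz' hzT' he
    rcases lt_trichotomy (m z) (m z') with hlt | heq | hlt
    · exact absurd he (hc _ _ hlt z (hm1 z hz) hzT z' (hm1 z' hz') (hm2 z' hz' _ hlt) hzT')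
    · simp only [← heq] at he
      exact (h _).inj z (hm1 z hz) hzT z' (heq ▸ hm1 z' hz') hzT' he
    · exact absurd he.symm (hc _ _ hlt z' (hm1 z' hz') hzT' z (hm1 z hz) (hm2 z hz _ hlt) hzT)
  · have key : ∀ i, ∀ z ∈ W i, ∃ F : Set V, F.Finite ∧ z ∈ F ∧ F ⊆ ⋃ i, W i ∧
        ∀ w ∈ F, w ∉ T → s (m w) w ∈ F := by
      intro i
      induction i using WellFoundedLT.induction with
      | ind i ih =>
        intro z hz
        choose! f g1 g2 g3 g4 using ih
        obtain ⟨F, f1, f2, f3, f4⟩ := (h i).fin z hz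
        refine ⟨F ∪ ⋃ w ∈ {w ∈ F | m w < i}, f (m w) w, f1.union ((f1.subset
          (Set.sep_subset _ _)).biUnion fun w hw => g1 _ hw.2 w
            (hm1 w (Set.mem_iUnion.2 ⟨i, f3 hw.1⟩))), Or.inl f2, ?_, ?_⟩
        · rintro w (hw | hw)
          · exact Set.mem_iUnion.2 ⟨i, f3 hw⟩
          · simp only [Set.mem_iUnion] at hw
            obtain ⟨a, ha, hw⟩ := hw
            exact g3 _ ha.2 a (hm1 a (Set.mem_iUnion.2 ⟨i, f3 ha.1⟩)) hw
        · rintro w (hw | hw) hwT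
          · have hwU : w ∈ ⋃ i, W i := Set.mem_iUnion.2 ⟨i, f3 hw⟩
            rcases (hmle i w (f3 hw)).lt_or_eq with hlt | heq
            · exact Or.inr (Set.mem_biUnion (show w ∈ {w ∈ F | m w < i} from ⟨hw, hlt⟩)
                (g4 _ hlt w (hm1 w hwU) w (g2 _ hlt w (hm1 w hwU)) hwT))
            · rw [heq]; exact Or.inl (f4 w hw hwT)
          · simp only [Set.mem_iUnion] at hw
            obtain ⟨a, ha, hw⟩ := hw
            have haU := hm1 a (Set.mem_iUnion.2 ⟨i, f3 ha.1⟩)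
            exact Or.inr (Set.mem_biUnion ha (g4 _ ha.2 a haU w hw hwT))
    intro z hz
    obtain ⟨i, hi⟩ := Set.mem_iUnion.1 hz
    exact key i z hi

/-- A vertex that is neither required to start a path nor a successor frees a target. -/
theorem stray (h : Linkage D Z T X σ) {p : V} (hp : p ∈ Z) (hpX : p ∉ X)
    (hr : ∀ z ∈ Z, z ∉ T → σ z ≠ p) :
    ∃ t ∈ T, t ∈ Z ∧ t ∉ X ∧ ∃ σ', Linkage D Z T (insert t X) σ' := by
  classical
  obtain ⟨k, hk, hb⟩ := h.reach hp hr
  have hin : ∀ i ≤ k, σ^[i] p ∈ Z := fun i hi => h.mem_iter hp i fun j hj => hb j (by omega)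
  have hoX : ∀ i ≤ k, σ^[i] p ∉ X := by
    intro i hi
    cases i with
    | zero => exact hpX
    | succ i =>
      rw [Function.iterate_succ_apply']
      exact h.avoid _ (hin i (by omega)) (hb i (by omega))
  let O : Set V := {z | ∃ i < k, z = σ^[i] p}
  have hpre : ∀ z ∈ Z, z ∉ T → ∀ i ≤ k, σ z = σ^[i] p → z ∈ O := by
    intro z hz hzT i hi he
    cases i with
    | zero => exact absurd he (hr z hz hzT)
    | succ i =>
      rw [Function.iterate_succ_apply'] at he
      exact ⟨i, by omega, h.inj z hz hzT _ (hin i (by omega)) (hb i (by omega)) he⟩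
  refine ⟨_, hk, hin k le_rfl, hoX k le_rfl, fun z => if z ∈ O then z else σ z, ?_, ?_, ?_, ?_, ?_⟩
  · intro z hz hzT
    by_cases hO : z ∈ O
    · simp only [hO, if_true]; exact hz
    · simp only [hO, if_false]; exact h.maps z hz hzT
  · intro z hz hzT
    by_cases hO : z ∈ O
    · simp only [hO, if_true]; exact Or.inl trivial
    · simp only [hO, if_false]; exact h.edge z hz hzT
  · intro z hz hzT
    by_cases hO : z ∈ O
    · simp only [hO, if_true]
      rintro (he | he)
      · exact hzT (he ▸ hk)
      · obtain ⟨i, hi, rfl⟩ := hO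
        exact hoX i hi.le he
    · simp only [hO, if_false]
      rintro (he | he)
      · exact hO (hpre z hz hzT k le_rfl he)
      · exact h.avoid z hz hzT he
  · intro z hz hzT z' hz' hzT' he
    by_cases hO : z ∈ O <;> by_cases hO' : z' ∈ O <;> simp only [hO, hO', if_true, if_false] at he
    · exact he
    · obtain ⟨i, hi, rfl⟩ := hO
      exact absurd (hpre z' hz' hzT' i hi.le he.symm) hO'
    · obtain ⟨i, hi, rfl⟩ := hO'
      exact absurd (hpre z hz hzT i hi.le he) hO
    · exact h.inj z hz hzT z' hz' hzT' he
  · intro z hz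
    obtain ⟨F, h1, h2, h3, h4⟩ := h.fin z hz
    refine ⟨F, h1, h2, h3, fun w hw hwT => ?_⟩
    by_cases hO : w ∈ O
    · simp only [hO, if_true]; exact hw
    · simp only [hO, if_false]; exact h4 w hw hwT

theorem tooMany (h : Linkage D Z T X σ) {y : V} (hy : y ∈ Z) (hyT : y ∉ T) :
    ∃ t ∈ insert y T, t ∈ Z ∧ t ∉ X ∧ ∃ σ', Linkage D Z (insert y T) (insert t X) σ' := by
  refine (h.mono_target (Set.subset_insert y T)).stray (h.maps y hy hyT) (h.avoid y hy hyT) ?_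
  intro z hz hzT he
  have hzT' : z ∉ T := fun hh => hzT (Or.inr hh)
  exact hzT (Or.inl (h.inj z hz hzT' y hy hyT he))

/-- `b` can be reached from `y` by a path alternating with `σ` in `n` steps. -/
def Alt (D : Set (V × V)) (Z T : Set V) (y : V) (σ : V → V) : ℕ → V → Prop
  | 0, b => y = b ∨ (y, b) ∈ D
  | n + 1, b => ∃ a ∈ Z, a ∉ insert y T ∧ (a = b ∨ (a, b) ∈ D) ∧ Alt D Z T y σ n (σ a)

theorem update {a b : V} {X1 T' : Set V} (h : Linkage D Z T {b} σ)
    [DecidableEq V] (hT' : T ⊆ insert a T') (hb : b ∈ Z) (hbX : b ∉ X1)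
    (hX : ∀ z ∈ Z, z ∉ T → z ≠ a → σ z ∉ X1)
    (hab : a = b ∨ (a, b) ∈ D) : Linkage D Z T' X1 (Function.update σ a b) := by
  have hnT : ∀ z, z ≠ a → z ∉ T' → z ∉ T := fun z hz hzT hh =>
    (hT' hh).elim hz hzT
  refine ⟨?_, ?_, ?_, ?_, ?_⟩
  · intro z hz hzT
    by_cases hza : z = a
    · subst hza; simpa using hb
    · simpa [hza] using h.maps z hz (hnT z hza hzT)
  · intro z hz hzT
    by_cases hza : z = a
    · subst hza; simpa [eq_comm] using hab
    · simpa [hza] using h.edge z hz (hnT z hza hzT)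
  · intro z hz hzT
    by_cases hza : z = a
    · subst hza; simpa using hbX
    · have := hX z hz (hnT z hza hzT) hza
      simpa only [Function.update_of_ne hza] using this
  · intro z hz hzT z' hz' hzT' he
    by_cases hza : z = a <;> by_cases hza' : z' = a
    · rw [hza, hza']
    · subst hza
      simp only [Function.update_self, Function.update_of_ne hza'] at he
      exact absurd he.symm (h.avoid z' hz' (hnT z' hza' hzT'))
    · subst hza'
      simp only [Function.update_self, Function.update_of_ne hza] at he
      exact absurd he (h.avoid z hz (hnT z hza hzT))
    · simp only [Function.update_of_ne hza, Function.update_of_ne hza'] at he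
      exact h.inj z hz (hnT z hza hzT) z' hz' (hnT z' hza' hzT') he
  · intro z hz
    obtain ⟨F, h1, h2, h3, h4⟩ := h.fin z hz
    obtain ⟨F', h1', h2', h3', h4'⟩ := h.fin b hb
    refine ⟨F ∪ F', h1.union h1', Or.inl h2, Set.union_subset h3 h3', fun w hw hwT => ?_⟩
    by_cases hwa : w = a
    · subst hwa; simpa using Or.inr h2'
    · simp only [Function.update_of_ne hwa]
      exact hw.imp (fun hw => h4 w hw (hnT w hwa hwT)) fun hw => h4' w hw (hnT w hwa hwT)

theorem augment_aux {y : V} : ∀ n (σ : V → V) (b : V) (X0 : Set V),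
    Linkage D Z (insert y T) (insert b X0) σ → b ∈ Z → b ∉ X0 → Alt D Z T y σ n b →
    ∃ σ', Linkage D Z T X0 σ' := by
  classical
  intro n
  induction n using Nat.strong_induction_on with
  | _ n ih =>
    intro σ b X0 h hb hbX hA
    by_cases hlow : ∃ m < n, Alt D Z T y σ m b
    · obtain ⟨m, hm, hA'⟩ := hlow
      exact ih m hm σ b X0 h hb hbX hA'
    push Not at hlow
    have hb' : Linkage D Z (insert y T) {b} σ := h.avoid_of (by rintro _ rfl _; exact Or.inl rfl)
    cases n with
    | zero =>
      exact ⟨_, hb'.update (a := y) subset_rfl hb hbX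
        (fun z hz hzT _ hh => h.avoid z hz hzT (Or.inr hh)) hA⟩
    | succ n =>
      obtain ⟨a, haZ, haT, hab, hA⟩ := hA
      have hav := h.avoid a haZ haT
      simp only [Set.mem_insert_iff, not_or] at hav
      have h1 : Linkage D Z (insert y T) (insert (σ a) X0) (Function.update σ a b) := by
        refine hb'.update (Set.subset_insert _ _) hb ?_ ?_ hab
        · rintro (he | he)
          exacts [hav.1 he.symm, hbX he]
        · rintro z hz hzT hza (he | he)
          exacts [hza (h.inj z hz hzT a haZ haT he), h.avoid z hz hzT (Or.inr he)]
      refine ih n (by omega) _ (σ a) X0 h1 (h.maps a haZ haT) hav.2 ?_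
      have : ∀ m ≤ n, ∀ c, Alt D Z T y σ m c → Alt D Z T y (Function.update σ a b) m c := by
        intro m
        induction m with
        | zero => exact fun _ _ h => h
        | succ m ihm =>
          rintro hm c ⟨a', k1, k2, k3, k4⟩
          refine ⟨a', k1, k2, k3, ?_⟩
          by_cases haa : a' = a
          · subst haa
            exact absurd ⟨a', k1, k2, hab, k4⟩ (hlow (m + 1) (by omega))
          · rw [Function.update_of_ne haa]
            exact ihm (by omega) _ k4
      exact this n le_rfl _ hA

theorem augment {y : V} {M : Set V} (h : Linkage D Z (insert y T) (entrance D Z ∪ M) σ)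
    (hy : y ∈ Z) (hyT : y ∉ T) (hM : M ⊆ Z) (hMT : M ⊆ T) (hME : ∀ t ∈ M, t ∉ entrance D Z) :
    (∃ t ∈ M, ∃ σ', Linkage D Z T (entrance D Z ∪ M \ {t}) σ') ∨
    ∃ Z' ⊆ Z, M ⊆ Z' ∧ y ∉ Z' ∧ (∀ t ∈ M, t ∉ entrance D Z') ∧
      Linkage D Z' T (entrance D Z' ∪ M) σ := by
  by_cases hex : ∃ t ∈ M, ∃ n, Alt D Z T y σ n t
  · obtain ⟨t, htM, n, hA⟩ := hex
    refine Or.inl ⟨t, htM, augment_aux (y := y) n σ t _ (h.avoid_of ?_) (hM htM) ?_ hA⟩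
    · rintro x (rfl | hx | hx) _
      exacts [Or.inr htM, Or.inl hx, Or.inr hx.1]
    · rintro (hx | hx)
      exacts [hME t htM hx, hx.2 rfl]
  push Not at hex
  let K : Set V := {b ∈ Z | ∀ n, ¬ Alt D Z T y σ n b}
  let Z' : Set V := {z ∈ Z | z ∈ K ∨ (z ∉ insert y T ∧ σ z ∈ K) ∨ z ∈ T}
  have hyK : y ∉ K := fun hh => hh.2 0 (Or.inl rfl)
  have hyZ' : y ∉ Z' := by
    rintro ⟨_, hh | hh | hh⟩
    exacts [hyK hh, hh.1 (Or.inl rfl), hyT hh]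
  have hne : ∀ z ∈ Z', z ≠ y := fun z hz he => hyZ' (he ▸ hz)
  have hK : ∀ z ∈ Z', z ∉ T → σ z ∈ K := by
    rintro z hz hzT
    have hzy : z ∉ insert y T := fun hh => hh.elim (hne z hz) hzT
    rcases hz.2 with hh | hh | hh
    · exact ⟨h.maps z hz.1 hzy, fun n hA => hh.2 (n + 1) ⟨z, hz.1, hzy, Or.inl rfl, hA⟩⟩
    · exact hh.2
    · exact absurd hh hzT
  have hKE : ∀ p ∈ K, p ∉ entrance D Z → p ∉ entrance D Z' := by
    rintro p hp hpE ⟨_, q, hq, hqp⟩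
    by_cases hqZ : q ∈ Z
    · have hqT : q ∉ T := fun hh => hq ⟨hqZ, Or.inr (Or.inr hh)⟩
      have hqy : q ≠ y := by
        rintro rfl
        exact hp.2 0 (Or.inr hqp)
      have hqi : q ∉ insert y T := fun hh => hh.elim hqy hqT
      refine hq ⟨hqZ, Or.inr (Or.inl ⟨hqi, h.maps q hqZ hqi, fun n hA => ?_⟩)⟩
      exact hp.2 (n + 1) ⟨q, hqZ, hqi, Or.inr hqp, hA⟩
    · exact hpE ⟨hp.1, q, hqZ, hqp⟩
  refine Or.inr ⟨Z', fun z hz => hz.1, fun t ht => ⟨hM ht, Or.inr (Or.inr (hMT ht))⟩, hyZ',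
    fun t ht => hKE t ⟨hM ht, hex t ht⟩ (hME t ht), ?_⟩
  have hT : ∀ z ∈ Z', z ∉ T → z ∉ insert y T := fun z hz hzT hh => hh.elim (hne z hz) hzT
  have hmaps : ∀ z ∈ Z', z ∉ T → σ z ∈ Z' := fun z hz hzT =>
    ⟨h.maps z hz.1 (hT z hz hzT), Or.inl (hK z hz hzT)⟩
  refine ⟨hmaps, fun z hz hzT => h.edge z hz.1 (hT z hz hzT), ?_,
    fun z hz hzT z' hz' hzT' => h.inj z hz.1 (hT z hz hzT) z' hz'.1 (hT z' hz' hzT'), ?_⟩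
  · intro z hz hzT hh
    have hav := h.avoid z hz.1 (hT z hz hzT)
    rcases hh with hh | hh
    · exact hKE _ (hK z hz hzT) (fun hh => hav (Or.inl hh)) hh
    · exact hav (Or.inr hh)
  · intro z hz
    obtain ⟨F, h1, h2, h3, h4⟩ := h.fin z hz.1
    exact ⟨F ∩ Z', h1.subset Set.inter_subset_left, ⟨h2, hz⟩, Set.inter_subset_right,
      fun w hw hwT => ⟨h4 w hw.1 (hT w hw.2 hwT), hmaps w hw.2 hwT⟩⟩

end Linkage

end

section

/-- A wave: a set avoiding the root whose entrance is linked inside it onto targets. -/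
def IsWave (D : Set (V × V)) (T : Set V) (r : V) (Z : Set V) : Prop :=
  r ∉ Z ∧ ∃ σ, Linkage D Z T (entrance D Z) σ

/-- A wave whose linkage can be chosen to leave the targets in `M` free. -/
def IsHind (D : Set (V × V)) (T : Set V) (r : V) (Z M : Set V) : Prop :=
  r ∉ Z ∧ M ⊆ Z ∧ M ⊆ T ∧ (∀ t ∈ M, t ∉ entrance D Z) ∧ ∃ σ, Linkage D Z T (entrance D Z ∪ M) σ

/-- The web of `D` with target set `T` is unhindered. -/
def Unhindered (D : Set (V × V)) (T : Set V) (r : V) : Prop := ∀ Z t, ¬ IsHind D T r Z {t}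

variable {D : Set (V × V)} {T : Set V} {r : V} {Z M : Set V}

theorem IsHind.anti {M' : Set V} (h : IsHind D T r Z M) (hM : M' ⊆ M) : IsHind D T r Z M' := by
  obtain ⟨h1, h2, h3, h4, σ, h5⟩ := h
  exact ⟨h1, hM.trans h2, hM.trans h3, fun t ht => h4 t (hM ht), σ,
    h5.avoid_of fun x hx _ => hx.imp id fun hx => hM hx⟩

theorem IsHind.isWave (h : IsHind D T r Z M) : IsWave D T r Z := by
  obtain ⟨h1, h2, h3, h4, σ, h5⟩ := h
  exact ⟨h1, σ, h5.avoid_of fun x hx _ => Or.inl hx⟩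

theorem IsWave.isHind (h : IsWave D T r Z) : IsHind D T r Z ∅ := by
  obtain ⟨h1, σ, h5⟩ := h
  exact ⟨h1, by simp, by simp, by simp, σ, by simpa using h5⟩

theorem IsHind.mono_target {T' : Set V} (h : IsHind D T r Z M) (hT : T ⊆ T') :
    IsHind D T' r Z M := by
  obtain ⟨h1, h2, h3, h4, σ, h5⟩ := h
  exact ⟨h1, h2, h3.trans hT, h4, σ, h5.mono_target hT⟩

theorem Unhindered.anti {T' : Set V} (h : Unhindered D T' r) (hT : T ⊆ T') : Unhindered D T r :=
  fun Z t ht => h Z t (ht.mono_target hT)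

theorem IsHind.reduce {y : V} (h : IsHind D (insert y T) r Z M) (hyT : y ∉ T) :
    (∃ Z' ⊆ Z, IsHind D T r Z' M) ∨ ∃ m ∈ M, y ∈ Z ∧ IsHind D T r Z (M \ {m}) := by
  classical
  obtain ⟨h1, h2, h3, h4, σ, h5⟩ := h
  by_cases hyZ : y ∈ Z
  · by_cases hyM : y ∈ M
    · refine Or.inr ⟨y, hyM, hyZ, h1, fun t ht => h2 ht.1, fun t ht => (h3 ht.1).resolve_left ht.2,
        fun t ht => h4 t ht.1, Function.update σ y y, ?_⟩
      refine (h5.avoid_of ?_).update (a := y) subset_rfl hyZ ?_ ?_ (Or.inl rfl)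
      · rintro _ rfl _
        exact Or.inr hyM
      · rintro (hh | hh)
        exacts [h4 y hyM hh, hh.2 rfl]
      · rintro z hz hzT _ hh
        exact h5.avoid z hz hzT (hh.imp id fun hh => hh.1)
    · have hMT : M ⊆ T := fun t ht => (h3 ht).resolve_left fun he => hyM (he ▸ ht)
      rcases h5.augment hyZ hyT h2 hMT h4 with ⟨t, htM, σ', h'⟩ | ⟨Z', a1, a2, a3, a4, a5⟩
      · exact Or.inr ⟨t, htM, hyZ, h1, fun t ht => h2 ht.1, fun t ht => hMT ht.1,
          fun t ht => h4 t ht.1, σ', h'⟩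
      · exact Or.inl ⟨Z', a1, fun hh => h1 (a1 hh), a2, hMT, a4, σ, a5⟩
  · refine Or.inl ⟨Z, subset_rfl, h1, h2,
      fun t ht => (h3 ht).resolve_left fun he => hyZ (he ▸ h2 ht), h4, σ,
      h5.mono_target_of_inter ?_⟩
    rintro x ⟨rfl | hx, hxZ⟩
    exacts [absurd hxZ hyZ, hx]

theorem IsHind.reduce_finset (F : Finset V) : ∀ {Z M : Set V}, IsHind D (T ∪ F) r Z M →
    ∃ Z' ⊆ Z, ∃ N : Finset V, N.card ≤ F.card ∧ IsHind D T r Z' (M \ N) := by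
  classical
  induction F using Finset.induction_on with
  | empty => exact fun {Z M} h => ⟨Z, subset_rfl, ∅, le_rfl, by simpa using h⟩
  | insert y F hy ih =>
    intro Z M h
    rw [Finset.coe_insert, Set.union_insert] at h
    by_cases hyT : y ∈ T ∪ F
    · rw [Set.insert_eq_of_mem hyT] at h
      obtain ⟨Z', a, N, b, c⟩ := ih h
      exact ⟨Z', a, N, b.trans (Finset.card_le_card (Finset.subset_insert _ _)), c⟩
    · rcases h.reduce hyT with ⟨Z', hZ', h'⟩ | ⟨m, hm, -, h'⟩
      · obtain ⟨Z', a, N, b, c⟩ := ih h'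
        exact ⟨Z', a.trans hZ', N, b.trans (Finset.card_le_card (Finset.subset_insert _ _)), c⟩
      · obtain ⟨Z', a, N, b, c⟩ := ih h'
        refine ⟨Z', a, insert m N, ?_, c.anti ?_⟩
        · rw [Finset.card_insert_of_notMem hy]
          exact (Finset.card_insert_le _ _).trans (by omega)
        · rintro x ⟨hx, hxN⟩
          simp only [Finset.coe_insert, Set.mem_insert_iff, not_or] at hxN
          exact ⟨⟨hx, hxN.1⟩, hxN.2⟩

theorem IsWave.add_finset (h : IsWave D T r Z) (Y : Finset V) : (↑Y ⊆ Z) → (∀ y ∈ Y, y ∉ T) →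
    ∃ M : Finset V, M.card = Y.card ∧ IsHind D (T ∪ Y) r Z M := by
  classical
  induction Y using Finset.induction_on with
  | empty => exact fun _ _ => ⟨∅, rfl, by simpa using h.isHind⟩
  | insert y Y hy ih =>
    intro hYZ hYT
    obtain ⟨M, hM, h1, h2, h3, h4, σ, h5⟩ := ih
      (fun x hx => hYZ (by simp at hx ⊢; exact Or.inr hx))
      fun x hx => hYT x (Finset.mem_insert_of_mem hx)
    have hyT : y ∉ T ∪ Y := by
      rintro (hh | hh)
      exacts [hYT y (Finset.mem_insert_self _ _) hh, hy hh]
    obtain ⟨t, ht, htZ, htX, σ', h'⟩ := h5.tooMany (hYZ (by simp)) hyT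
    refine ⟨insert t M, ?_, h1, ?_, ?_, ?_, σ', ?_⟩
    · rw [Finset.card_insert_of_notMem hy, Finset.card_insert_of_notMem, hM]
      exact fun hh => htX (Or.inr hh)
    · rw [Finset.coe_insert]; exact Set.insert_subset htZ h2
    · rw [Finset.coe_insert, Finset.coe_insert, Set.union_insert]
      exact Set.insert_subset ht (h3.trans (Set.subset_insert _ _))
    · intro x hx
      rcases Finset.mem_insert.1 (Finset.mem_coe.1 hx) with rfl | hx
      exacts [fun hh => htX (Or.inl hh), h4 x hx]
    · rw [Finset.coe_insert, Finset.coe_insert, Set.union_insert, Set.union_insert]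
      exact h'

theorem IsWave.exchange {F Y : Finset V} (h : IsWave D (T ∪ F) r Z) (hYZ : ↑Y ⊆ Z)
    (hY : ∀ y ∈ Y, y ∉ T ∪ F) (hc : F.card < Y.card) : ¬ Unhindered D (T ∪ Y) r := by
  classical
  intro hU
  obtain ⟨M, hM, h'⟩ := h.add_finset Y hYZ hY
  rw [Set.union_right_comm] at h'
  obtain ⟨Z', -, N, hN, h''⟩ := h'.reduce_finset
  obtain ⟨t, ht, htN⟩ := Finset.exists_mem_notMem_of_card_lt_card (show N.card < M.card by omega)
  exact hU Z' t (h''.anti (by rintro _ rfl; exact ⟨ht, htN⟩))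

theorem Unhindered.insert_target {y : V} (h : Unhindered D T r)
    (hy : ∀ Z, IsWave D T r Z → y ∉ Z) : Unhindered D (insert y T) r := by
  intro Z t hZ
  by_cases hyT : y ∈ T
  · rw [Set.insert_eq_of_mem hyT] at hZ
    exact h Z t hZ
  rcases hZ.reduce hyT with ⟨Z', -, h'⟩ | ⟨m, -, hyZ, h'⟩
  exacts [h Z' t h', hy Z h'.isWave hyZ]

theorem del_del (D : Set (V × V)) (K K' : Set V) : del (del D K) K' = del D (K ∪ K') := by
  ext e; simp only [del, Set.mem_ofPred_eq, Set.mem_union, not_or]; tauto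

theorem del_subset (D : Set (V × V)) (K : Set V) : del D K ⊆ D := fun _ h => h.1

theorem del_empty (D : Set (V × V)) : del D ∅ = D := by
  ext e; simp [del]

theorem IsHind.del_singleton {t k : V} (h : IsHind D T r Z {t}) (hk : k ∉ T) :
    ∃ Z' ⊆ Z, k ∉ Z' ∧ ∃ t', IsHind (del D {k}) T r Z' {t'} := by
  obtain ⟨h1, h2, h3, h4, σ, h5⟩ := h
  have htZ : t ∈ Z := h2 rfl
  have htT : t ∈ T := h3 rfl
  have htE := h4 t rfl
  have htk : t ≠ k := fun he => hk (he ▸ htT)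
  have hE : ∀ x, x ∈ entrance (del D {k}) (Z \ {k}) → x ∈ entrance D Z := by
    rintro x ⟨hx, q, hq, hqx⟩
    refine ⟨hx.1, q, fun hh => hq ⟨hh, hqx.2.1⟩, hqx.1⟩
  have key : ∀ T', T ⊆ T' → (∀ z ∈ Z, z ≠ k → z ∉ T' → σ z ≠ k) →
      Linkage (del D {k}) (Z \ {k}) T' (entrance (del D {k}) (Z \ {k}) ∪ {t}) σ := by
    intro T' hT' hne
    have h5' := h5.mono_target hT'
    have hm : ∀ z ∈ Z \ {k}, z ∉ T' → σ z ∈ Z \ {k} := fun z hz hzT =>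
      ⟨h5'.maps z hz.1 hzT, hne z hz.1 hz.2 hzT⟩
    refine ⟨hm, ?_, ?_, ?_, ?_⟩
    · intro z hz hzT
      exact (h5'.edge z hz.1 hzT).imp id fun he => ⟨he, hz.2, hne z hz.1 hz.2 hzT⟩
    · exact fun z hz hzT hh => h5'.avoid z hz.1 hzT (hh.imp (hE _) id)
    · exact fun z hz hzT z' hz' hzT' => h5'.inj z hz.1 hzT z' hz'.1 hzT'
    · intro z hz
      obtain ⟨F, f1, f2, f3, f4⟩ := h5'.fin z hz.1
      exact ⟨F \ {k}, f1.subset Set.sdiff_subset, ⟨f2, hz.2⟩, fun w hw => ⟨f3 hw.1, hw.2⟩,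
        fun w hw hwT => ⟨f4 w hw.1 hwT, hne w (f3 hw.1) hw.2 hwT⟩⟩
  have hr : r ∉ Z \ {k} := fun hh => h1 hh.1
  by_cases hex : ∃ z0 ∈ Z, z0 ≠ k ∧ z0 ∉ T ∧ σ z0 = k ∧ k ∈ Z
  · obtain ⟨z0, hz0, hz0k, hz0T, hz0σ, hkZ⟩ := hex
    have hl := key (insert z0 T) (Set.subset_insert _ _) (by
      intro z hz hzk hzT hzσ
      simp only [Set.mem_insert_iff, not_or] at hzT
      exact hzT.1 (h5.inj z hz hzT.2 z0 hz0 hz0T (hzσ.trans hz0σ.symm)))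
    have hkk : σ k ≠ k := fun he => hz0k (h5.inj z0 hz0 hz0T k hkZ hk (hz0σ.trans he.symm))
    have hav := h5.avoid k hkZ hk
    obtain ⟨t2, ht2, ht2Z, ht2X, σ', h'⟩ := hl.stray (p := σ k) ⟨h5.maps k hkZ hk, hkk⟩
      (fun hh => hav (hh.imp (hE _) id)) (by
        intro z hz hzT he
        exact hz.2 (h5.inj z hz.1 (fun hh => hzT (Or.inr hh)) k hkZ hk he))
    have hH : IsHind (del D {k}) (insert z0 T) r (Z \ {k}) {t, t2} := by
      refine ⟨hr, ?_, ?_, ?_, σ', h'.avoid_of ?_⟩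
      · rintro _ (rfl | rfl)
        exacts [⟨htZ, htk⟩, ht2Z]
      · rintro _ (rfl | rfl)
        exacts [Or.inr htT, ht2]
      · rintro _ (rfl | rfl)
        exacts [fun hh => htE (hE _ hh), fun hh => ht2X (Or.inl hh)]
      · rintro x (hx | rfl | rfl) _
        exacts [Or.inr (Or.inl hx), Or.inr (Or.inr rfl), Or.inl rfl]
    have htt : t2 ≠ t := fun he => ht2X (Or.inr he)
    rcases hH.reduce hz0T with ⟨Z', hZ', hh⟩ | ⟨m, -, -, hh⟩
    · exact ⟨Z', fun z hz => (hZ' hz).1, fun hk => (hZ' hk).2 rfl, t, hh.anti (by simp)⟩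
    · refine ⟨Z \ {k}, Set.sdiff_subset, fun hk => hk.2 rfl, ?_⟩
      by_cases hm : m = t
      · exact ⟨t2, hh.anti (by rintro _ rfl; exact ⟨by simp, fun he => htt (he.trans hm)⟩)⟩
      · exact ⟨t, hh.anti (by rintro _ rfl; exact ⟨by simp, fun he => hm he.symm⟩)⟩
  · push Not at hex
    refine ⟨Z \ {k}, Set.sdiff_subset, fun hk => hk.2 rfl, t, hr, ?_, ?_, ?_, σ,
      key T subset_rfl ?_⟩
    · rintro _ rfl
      exact ⟨htZ, htk⟩
    · rintro _ rfl
      exact htT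
    · rintro _ rfl hh
      exact htE (hE _ hh)
    · intro z hz hzk hzT he
      exact hex z hz hzk hzT he (he ▸ h5.maps z hz hzT)

theorem IsHind.del_finset (K : Finset V) : ∀ {D : Set (V × V)} {Z : Set V} {t : V},
    IsHind D T r Z {t} → (∀ k ∈ K, k ∉ T) →
    ∃ Z' ⊆ Z, (∀ k ∈ K, k ∉ Z') ∧ ∃ t', IsHind (del D K) T r Z' {t'} := by
  classical
  induction K using Finset.induction_on with
  | empty => exact fun {D Z t} h _ => ⟨Z, subset_rfl, by simp, t, by simpa [del_empty] using h⟩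
  | insert k K hk ih =>
    intro D Z t h hK
    obtain ⟨Z1, a1, a2, t1, h1⟩ := h.del_singleton (hK k (Finset.mem_insert_self _ _))
    obtain ⟨Z2, b1, b2, t2, h2⟩ := ih h1 fun x hx => hK x (Finset.mem_insert_of_mem hx)
    refine ⟨Z2, b1.trans a1, ?_, t2, ?_⟩
    · intro x hx
      rcases Finset.mem_insert.1 hx with rfl | hx
      exacts [fun hh => a2 (b1 hh), b2 x hx]
    · rw [del_del] at h2
      rwa [Finset.coe_insert]

theorem IsHind.del_finite {K : Set V} (hK : K.Finite) {t : V} (h : IsHind D T r Z {t})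
    (hKT : ∀ k ∈ K, k ∉ T) :
    ∃ Z' ⊆ Z, (∀ k ∈ K, k ∉ Z') ∧ ∃ t', IsHind (del D K) T r Z' {t'} := by
  have := h.del_finset hK.toFinset (fun k hk => hKT k (by simpa using hk))
  simpa using this

open Classical in
/-- Composition of a wave with a wave targeting it. -/
theorem Linkage.comb_wave {Z2 M X2 : Set V} {σ σ2 : V → V} (h : Linkage D Z T (entrance D Z ∪ M) σ)
    (h2 : Linkage D Z2 (T ∪ Z) X2 σ2)
    (hX2 : ∀ x ∈ Z2, x ∈ entrance D (Z ∪ Z2) ∪ M → x ∈ X2) :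
    Linkage D (Z ∪ Z2) T (entrance D (Z ∪ Z2) ∪ M) (fun z => if z ∈ Z then σ z else σ2 z) := by
  refine (h.avoid_of ?_).comb (h2.avoid_of fun x hx hxZ => hX2 x hxZ hx) ?_
  · rintro x (⟨_, q, hq, hqx⟩ | hx) hxZ
    · exact Or.inl ⟨hxZ, q, fun hh => hq (Or.inl hh), hqx⟩
    · exact Or.inr hx
  · intro z hz hzT z' hz' hzZ' hzT' he
    have hm := h.maps z hz hzT
    rcases h2.edge z' hz' (by simp [hzZ', hzT']) with h' | h'
    · exact hzZ' (by rw [← h', ← he]; exact hm)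
    · exact h.avoid z hz hzT (Or.inl ⟨hm, z', hzZ', by rwa [he]⟩)

/-- The union of all waves. -/
def maxWave (D : Set (V × V)) (T : Set V) (r : V) : Set V := ⋃₀ {Z | IsWave D T r Z}

theorem IsWave.subset_maxWave (h : IsWave D T r Z) : Z ⊆ maxWave D T r :=
  Set.subset_sUnion_of_mem h

theorem root_notMem_maxWave : r ∉ maxWave D T r := by
  rintro ⟨Z, hZ, hr⟩
  exact hZ.1 hr

theorem isWave_maxWave (D : Set (V × V)) (T : Set V) (r : V) : IsWave D T r (maxWave D T r) := by
  refine ⟨root_notMem_maxWave, ?_⟩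
  obtain ⟨lo, wf⟩ := exists_wellFoundedLT {Z | IsWave D T r Z}
  choose s hs using fun i : {Z | IsWave D T r Z} => i.2.2
  unfold maxWave
  rw [Set.sUnion_eq_iUnion]
  refine Linkage.iUnion (s := s) (fun i => (hs i).avoid_of ?_) ?_
  · rintro x ⟨_, q, hq, hqx⟩ hx
    exact ⟨hx, q, fun hh => hq (Set.mem_iUnion.2 ⟨i, hh⟩), hqx⟩
  · intro i j _ z hz hzT z' hz' hzi' hzT' he
    have hm := (hs i).maps z hz hzT
    rcases (hs j).edge z' hz' hzT' with h' | h'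
    · exact hzi' (by rw [← h', ← he]; exact hm)
    · exact (hs i).avoid z hz hzT ⟨hm, z', hzi', by rwa [he]⟩

theorem Linkage.id (hX : ∀ x ∈ Z, x ∉ T → x ∉ M) : Linkage D Z T M _root_.id where
  maps z hz _ := hz
  edge _ _ _ := Or.inl rfl
  avoid := hX
  inj _ _ _ _ _ _ h := h
  fin z hz := ⟨{z}, Set.finite_singleton z, rfl, by simpa using hz, fun w hw _ => hw⟩

theorem isWave_of_subset (hZ : Z ⊆ T) (hr : r ∉ Z) : IsWave D T r Z :=
  ⟨hr, _, Linkage.id fun _ hx hxT => absurd (hZ hx) hxT⟩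

theorem target_subset_maxWave (hr : r ∉ T) : T ⊆ maxWave D T r :=
  (isWave_of_subset subset_rfl hr).subset_maxWave

theorem deleted_subset_maxWave {K : Set V} (hr : r ∉ K) : K ⊆ maxWave (del D K) T r := by
  refine IsWave.subset_maxWave ⟨hr, _, Linkage.id fun x hx _ => ?_⟩
  rintro ⟨_, q, _, hq⟩
  exact hq.2.2 hx

/-- The digraph of edges of `D` whose tail is outside `Z`. -/
def outside (D : Set (V × V)) (Z : Set V) : Set (V × V) := {e ∈ D | e.1 ∉ Z}

theorem IsWave.subset_maxWave_of_outside {W : Set V}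
    (h : IsWave (outside D (maxWave D T r)) (entrance D (maxWave D T r)) r W) :
    W ⊆ maxWave D T r := by
  classical
  obtain ⟨h1, σ, h5⟩ := h
  obtain ⟨hr, s, hs⟩ := isWave_maxWave D T r
  have hw : IsWave D T r (maxWave D T r ∪ W) := by
    refine ⟨fun hh => hh.elim hr h1, ?_⟩
    have := Linkage.comb_wave (M := ∅) (by simpa using hs)
      ((h5.graph (D' := D) fun z _ _ h => h.1).mono_target (T' := T ∪ maxWave D T r)
        fun x hx => Or.inr hx.1) ?_
    · exact ⟨_, by simpa using this⟩
    · rintro p hp (⟨_, q, hq, hqp⟩ | hh)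
      · exact ⟨hp, q, fun hh => hq (Or.inr hh), hqp, fun hh => hq (Or.inl hh)⟩
      · exact absurd hh (by simp)
  exact fun z hz => hw.subset_maxWave (Or.inr hz)

theorem unhindered_outside (D : Set (V × V)) (T : Set V) (r : V) :
    Unhindered (outside D (maxWave D T r)) (entrance D (maxWave D T r)) r := by
  intro W x hW
  have hsub := hW.isWave.subset_maxWave_of_outside
  obtain ⟨-, h2, h3, h4, -⟩ := hW
  obtain ⟨hx, q, hq, hqx⟩ := h3 rfl
  exact h4 x rfl ⟨h2 rfl, q, fun hh => hq (hsub hh), hqx, hq⟩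

theorem IsHind.undelete {K : Set V} (h : IsHind (del D K) T r Z M) (hr : r ∉ K)
    (hK : ∀ k ∈ K, k ∉ Z) : IsHind D (T ∪ K) r (K ∪ Z) M := by
  classical
  obtain ⟨h1, h2, h3, h4, σ, h5⟩ := h
  have hE : ∀ x ∈ Z, x ∈ entrance D (K ∪ Z) → x ∈ entrance (del D K) Z := by
    rintro x hx ⟨_, q, hq, hqx⟩
    exact ⟨hx, q, fun hh => hq (Or.inr hh), hqx, fun hh => hq (Or.inl hh), fun hh => hK x hh hx⟩
  refine ⟨fun hh => hh.elim hr h1, fun t ht => Or.inr (h2 ht), fun t ht => Or.inl (h3 ht),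
    fun t ht hh => h4 t ht (hE t (h2 ht) hh), fun z => if z ∈ K then z else σ z, ?_⟩
  exact Linkage.comb_wave (σ := _root_.id) (Linkage.id fun x hx hxT => absurd (Or.inr hx) hxT)
      ((h5.graph fun _ _ _ h => h.1).mono_target fun x hx => Or.inl (Or.inl hx))
      fun x hx hh => hh.imp (hE x hx) _root_.id

theorem Unhindered.del_singleton_target {t : V} (h : Unhindered D T r) (ht : t ∈ T)
    (hr : r ≠ t) : Unhindered (del D {t}) (T \ {t}) r := by
  intro Z x hZ
  obtain ⟨Z', -, ht', x', h'⟩ := hZ.del_singleton (k := t) (fun hh => hh.2 rfl)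
  rw [del_del, Set.union_self] at h'
  refine h _ x' ((h'.undelete hr (by rintro _ rfl; exact ht')).mono_target ?_)
  rintro y (hy | rfl)
  exacts [hy.1, ht]

end

section

variable {D : Set (V × V)} {T X Z : Set V} {r : V}

open Classical in
/-- Stop a linkage at once on a set `O` closed under predecessors. -/
theorem Linkage.freeze {T' O : Set V} {σ : V → V} (h : Linkage D Z T X σ)
    (hT : ∀ z ∈ Z, z ∈ T → z ∉ T' → z ∈ O) (hO : ∀ z ∈ O, z ∈ Z → z ∉ T' → z ∉ X)
    (hpre : ∀ z ∈ Z, z ∉ T → z ∉ T' → σ z ∈ O → σ z ∉ T' → z ∈ O) :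
    Linkage D Z T' X (fun z => if z ∈ O then z else σ z) := by
  have hn : ∀ z ∈ Z, z ∉ T' → z ∉ O → z ∉ T := fun z hz hzT hzO hh => hzO (hT z hz hh hzT)
  refine ⟨?_, ?_, ?_, ?_, ?_⟩
  · intro z hz hzT
    by_cases hzO : z ∈ O
    · simpa only [hzO, if_true] using hz
    · simpa only [hzO, if_false] using h.maps z hz (hn z hz hzT hzO)
  · intro z hz hzT
    by_cases hzO : z ∈ O
    · simp only [hzO, if_true, true_or]
    · simpa only [hzO, if_false] using h.edge z hz (hn z hz hzT hzO)
  · intro z hz hzT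
    by_cases hzO : z ∈ O
    · simpa only [hzO, if_true] using hO z hzO hz hzT
    · simpa only [hzO, if_false] using h.avoid z hz (hn z hz hzT hzO)
  · intro z hz hzT z' hz' hzT' he
    by_cases hzO : z ∈ O <;> by_cases hzO' : z' ∈ O <;>
      simp only [hzO, hzO', if_true, if_false] at he
    · exact he
    · exact absurd (hpre z' hz' (hn z' hz' hzT' hzO') hzT' (he ▸ hzO) (he ▸ hzT)) hzO'
    · exact absurd (hpre z hz (hn z hz hzT hzO) hzT (he ▸ hzO') (he ▸ hzT')) hzO
    · exact h.inj z hz (hn z hz hzT hzO) z' hz' (hn z' hz' hzT' hzO') he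
  · intro z hz
    obtain ⟨F, h1, h2, h3, h4⟩ := h.fin z hz
    refine ⟨F, h1, h2, h3, fun w hw hwT => ?_⟩
    by_cases hwO : w ∈ O
    · simpa only [hwO, if_true] using hw
    · simpa only [hwO, if_false] using h4 w hw (hn w (h3 hw) hwT hwO)

/-- `B` is a part of `U` meeting `Y` finitely on which `L` is a linkage of its own. -/
def Good (D : Set (V × V)) (X U Y : Set V) (L : V → V) (B : Set V) : Prop :=
  B ⊆ U ∧ (Y ∩ B).Finite ∧ ∀ w ∈ B, w ∉ X ∪ Y → L w ∈ B ∧ L w ∉ entrance D B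

/-- A linkage of `U` onto `X` together with additional targets `Y ⊆ S`, every finite part of which
can be added to `X` without creating a hindrance. -/
structure Coherent (D : Set (V × V)) (X : Set V) (r : V) (S U Y : Set V) (L : V → V) : Prop where
  root : r ∉ U
  sub : Y ⊆ U
  subS : Y ⊆ S
  disj : ∀ y ∈ Y, y ∉ X
  link : Linkage D U (X ∪ Y) (entrance D U) L
  unh : ∀ Y0 ⊆ Y, Y0.Finite → Unhindered D (X ∪ Y0) r
  good : ∀ z ∈ U, ∃ B, z ∈ B ∧ Good D X U Y L B

namespace Coherent

variable {S U Y : Set V} {L : V → V}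

theorem good_union {B B' : Set V} (h : Good D X U Y L B) (h' : Good D X U Y L B') :
    Good D X U Y L (B ∪ B') := by
  refine ⟨Set.union_subset h.1 h'.1, by rw [Set.inter_union_distrib_left]; exact h.2.1.union h'.2.1,
    ?_⟩
  rintro w (hw | hw) hwX
  · obtain ⟨h1, h2⟩ := h.2.2 w hw hwX
    exact ⟨Or.inl h1, fun ⟨_, q, hq, hqp⟩ => h2 ⟨h1, q, fun hh => hq (Or.inl hh), hqp⟩⟩
  · obtain ⟨h1, h2⟩ := h'.2.2 w hw hwX
    exact ⟨Or.inr h1, fun ⟨_, q, hq, hqp⟩ => h2 ⟨h1, q, fun hh => hq (Or.inr hh), hqp⟩⟩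

theorem good_finite (h : Coherent D X r S U Y L) {F : Set V} (hF : F.Finite) (hFU : F ⊆ U) :
    ∃ B, F ⊆ B ∧ Good D X U Y L B := by
  induction F, hF using Set.Finite.induction_on with
  | empty => exact ⟨∅, subset_rfl, by simp, by simp, by simp⟩
  | @insert a F _ _ ih =>
    obtain ⟨B, hB, hG⟩ := ih fun x hx => hFU (Or.inr hx)
    obtain ⟨B', haB', hG'⟩ := h.good a (hFU (Or.inl rfl))
    exact ⟨B' ∪ B, Set.insert_subset (Or.inl haB') (hB.trans Set.subset_union_right),
      good_union hG' hG⟩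

theorem link_good (h : Coherent D X r S U Y L) {B : Set V} (hB : Good D X U Y L B) :
    Linkage D B (X ∪ Y) (entrance D B) L where
  maps z hz hzT := (hB.2.2 z hz hzT).1
  edge z hz hzT := h.link.edge z (hB.1 hz) hzT
  avoid z hz hzT := (hB.2.2 z hz hzT).2
  inj z hz hzT z' hz' hzT' := h.link.inj z (hB.1 hz) hzT z' (hB.1 hz') hzT'
  fin z hz := by
    obtain ⟨F, h1, h2, h3, h4⟩ := h.link.fin z (hB.1 hz)
    exact ⟨F ∩ B, h1.subset Set.inter_subset_left, ⟨h2, hz⟩, Set.inter_subset_right,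
      fun w hw hwT => ⟨h4 w hw.1 hwT, (hB.2.2 w hw.2 hwT).1⟩⟩

theorem inter_wave (h : Coherent D X r S U Y L) {Y0 C : Set V} (hY0 : Y0 ⊆ Y) (hf : Y0.Finite)
    (hC : IsWave D (X ∪ Y0) r C) : Y ∩ C ⊆ Y0 := by
  classical
  rintro y ⟨hy, hyC⟩
  by_contra hy0
  have hC' : IsWave D (X ∪ Y0 ∪ (∅ : Finset V)) r C := by simpa using hC
  refine hC'.exchange (Y := {y}) (by simpa using hyC) ?_ (by simp) ?_
  · simp only [Finset.mem_singleton, forall_eq]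
    rintro ((hh | hh) | hh)
    exacts [h.disj y hy hh, hy0 hh, by simp at hh]
  · have := h.unh (Y0 ∪ {y}) (Set.union_subset hY0 (by simpa using hy)) (hf.union (by simp))
    rw [← Set.union_assoc] at this
    simpa using this

theorem wave_closed (h : Coherent D X r S U Y L) {Y0 C : Set V} (hY0 : Y0 ⊆ Y) (hf : Y0.Finite)
    (hC : IsWave D (X ∪ Y0) r C) {z : V} (hz : z ∈ C) (hzU : z ∈ U) (hzX : z ∉ X ∪ Y) :
    L z ∈ C ∧ L z ∉ entrance D C := by
  classical
  by_contra hcon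
  obtain ⟨B, hB, hG⟩ := h.good_finite (F := insert z Y0) (hf.insert z)
    (Set.insert_subset hzU (hY0.trans h.sub))
  obtain ⟨hr, σ, hσ⟩ := hC
  have hzB := hB (Or.inl rfl)
  have hT : ∀ w ∈ B, w ∉ X ∪ (Y ∩ B) → w ∉ X ∪ Y := by
    rintro w hw hwT (hh | hh)
    exacts [hwT (Or.inl hh), hwT (Or.inr ⟨hh, hw⟩)]
  have hL := h.link_good hG
  have h1 : Linkage D C (X ∪ (Y ∩ B)) (entrance D C ∪ ∅) σ := by
    rw [Set.union_empty]
    exact hσ.mono_target (Set.union_subset_union_right X fun y hy => ⟨hY0 hy, hB (Or.inr hy)⟩)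
  have h2 : Linkage D B (X ∪ (Y ∩ B) ∪ C) (entrance D B) L := hL.mono_target_of_inter (by
    rintro x ⟨hx | hx, hxB⟩
    exacts [Or.inl (Or.inl hx), Or.inl (Or.inr ⟨hx, hxB⟩)])
  have hE : ∀ x ∈ B, x ∈ entrance D (C ∪ B) ∪ ∅ → x ∈ entrance D B := by
    rintro x hx (⟨_, q, hq, hqx⟩ | hh)
    · exact ⟨hx, q, fun hh => hq (Or.inr hh), hqx⟩
    · exact absurd hh (by simp)
  have h3 := h1.comb_wave h2 hE
  have hLz := hG.2.2 z hzB hzX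
  obtain ⟨t, htT, htZ, htX, σ', h'⟩ := h3.stray (p := L z) (Or.inr hLz.1)
    (fun hh => hLz.2 (hE _ hLz.1 hh)) (by
      intro w hw hwT he
      by_cases hwC : w ∈ C
      · simp only [hwC, if_true] at he
        rw [← he] at hcon
        exact hcon ⟨h1.maps w hwC hwT, fun hh => h1.avoid w hwC hwT (Or.inl hh)⟩
      · simp only [hwC, if_false] at he
        have hwB := hw.resolve_left hwC
        exact hwC (hL.inj w hwB (hT w hwB hwT) z hzB hzX he ▸ hz))
  refine h.unh (Y ∩ B) Set.inter_subset_left hG.2.1 (C ∪ B) t ⟨?_, ?_, ?_, ?_, σ', h'.avoid_of ?_⟩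
  · rintro (hh | hh)
    exacts [hr hh, h.root (hG.1 hh)]
  · rintro _ rfl; exact htZ
  · rintro _ rfl; exact htT
  · rintro _ rfl hh; exact htX (Or.inl hh)
  · rintro x (hx | rfl) _
    exacts [Or.inr (Or.inl hx), Or.inl rfl]

theorem add_wave (h : Coherent D X r S U Y L) {Y0 C : Set V} (hY0 : Y0 ⊆ Y) (hf : Y0.Finite)
    (hC : IsWave D (X ∪ Y0) r C) :
    ∃ L', (∀ z ∈ U, L' z = L z) ∧ Coherent D X r S (U ∪ C) Y L' := by
  classical
  have hCl := fun z hz => h.wave_closed hY0 hf hC (z := z) hz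
  have hYC := h.inter_wave hY0 hf hC
  obtain ⟨hr, σ, hσ⟩ := hC
  refine ⟨fun z => if z ∈ U then L z else σ z, fun z hz => by simp [hz], ?_, ?_, h.subS, h.disj,
    ?_, h.unh, ?_⟩
  · rintro (hh | hh)
    exacts [h.root hh, hr hh]
  · exact h.sub.trans Set.subset_union_left
  · have := Linkage.comb_wave (M := ∅) (by simpa using h.link)
      (hσ.mono_target (T' := X ∪ Y ∪ U) ((Set.union_subset_union_right X hY0).trans
        Set.subset_union_left)) (by
        rintro x hx (⟨_, q, hq, hqx⟩ | hh)
        · exact ⟨hx, q, fun hh => hq (Or.inr hh), hqx⟩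
        · exact absurd hh (by simp))
    simpa using this
  · rintro z (hz | hz)
    · obtain ⟨B, hzB, h1, h2, h3⟩ := h.good z hz
      refine ⟨B, hzB, h1.trans Set.subset_union_left, h2, fun w hw hwX => ?_⟩
      simpa only [h1 hw, if_true] using h3 w hw hwX
    · refine ⟨C, hz, Set.subset_union_right, hf.subset hYC, fun w hw hwX => ?_⟩
      by_cases hwU : w ∈ U
      · simpa only [hwU, if_true] using hCl w hw hwU hwX
      · have hwT : w ∉ X ∪ Y0 := fun hh => hwX (hh.imp id fun hh => hY0 hh)
        simpa only [hwU, if_false] using ⟨hσ.maps w hw hwT, hσ.avoid w hw hwT⟩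

theorem add_vertex (h : Coherent D X r S U Y L) {s : V} (hs : s ∈ S) (hsU : s ∉ U) (hsr : r ≠ s)
    (hno : ∀ Y0 ⊆ Y, Y0.Finite → ∀ C, IsWave D (X ∪ Y0) r C → s ∉ C) :
    Coherent D X r S (insert s U) (insert s Y) L := by
  have hsX : s ∉ X := fun hh => hno ∅ (by simp) (by simp) {s}
    (isWave_of_subset (by simpa using hh) (by simpa using hsr)) rfl
  refine ⟨?_, ?_, ?_, ?_, ⟨?_, ?_, ?_, ?_, ?_⟩, ?_, ?_⟩
  · rintro (hh | hh)
    exacts [hsr hh, h.root hh]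
  · exact Set.insert_subset_insert h.sub
  · exact Set.insert_subset hs h.subS
  · rintro y (rfl | hy)
    exacts [hsX, h.disj y hy]
  · rintro z (rfl | hz) hzT
    · exact absurd (Or.inr (Or.inl rfl)) hzT
    · exact Or.inr (h.link.maps z hz fun hh => hzT (hh.imp id Or.inr))
  · rintro z (rfl | hz) hzT
    · exact absurd (Or.inr (Or.inl rfl)) hzT
    · exact h.link.edge z hz fun hh => hzT (hh.imp id Or.inr)
  · rintro z (rfl | hz) hzT
    · exact absurd (Or.inr (Or.inl rfl)) hzT
    · have hzT' : z ∉ X ∪ Y := fun hh => hzT (hh.imp id Or.inr)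
      rintro ⟨_, q, hq, hqz⟩
      exact h.link.avoid z hz hzT' ⟨h.link.maps z hz hzT', q, fun hh => hq (Or.inr hh), hqz⟩
  · rintro z (rfl | hz) hzT z' (rfl | hz') hzT' he
    · rfl
    · exact absurd (Or.inr (Or.inl rfl)) hzT
    · exact absurd (Or.inr (Or.inl rfl)) hzT'
    · exact h.link.inj z hz (fun hh => hzT (hh.imp id Or.inr)) z' hz'
        (fun hh => hzT' (hh.imp id Or.inr)) he
  · rintro z (rfl | hz)
    · refine ⟨{z}, by simp, rfl, by simp, ?_⟩
      rintro w rfl hwT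
      exact absurd (Or.inr (Or.inl rfl)) hwT
    · obtain ⟨F, h1, h2, h3, h4⟩ := h.link.fin z hz
      exact ⟨F, h1, h2, h3.trans (Set.subset_insert _ _),
        fun w hw hwT => h4 w hw fun hh => hwT (hh.imp id Or.inr)⟩
  · intro Y0 hY0 hf
    have h1 : Y0 \ {s} ⊆ Y := fun y hy => (hY0 hy.1).resolve_left hy.2
    have h2 : (Y0 \ {s}).Finite := hf.subset Set.sdiff_subset
    have := (h.unh _ h1 h2).insert_target (y := s) fun C hC => hno _ h1 h2 C hC
    refine this.anti ?_
    rintro y (hy | hy)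
    · exact Or.inr (Or.inl hy)
    · by_cases hys : y = s
      · exact Or.inl hys
      · exact Or.inr (Or.inr ⟨hy, hys⟩)
  · rintro z (rfl | hz)
    · refine ⟨{z}, rfl, by simp, (Set.finite_singleton z).subset Set.inter_subset_right, ?_⟩
      rintro w rfl hwT
      exact absurd (Or.inr (Or.inl rfl)) hwT
    · obtain ⟨B, hzB, h1, h2, h3⟩ := h.good z hz
      refine ⟨B, hzB, h1.trans (Set.subset_insert _ _), h2.subset ?_,
        fun w hw hwX => h3 w hw fun hh => hwX (hh.imp id Or.inr)⟩
      rintro y ⟨rfl | hy, hyB⟩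
      exacts [absurd (h1 hyB) hsU, ⟨hy, hyB⟩]

/-- The extension order on coherent triples. -/
def Le (a b : Set V × Set V × (V → V)) : Prop :=
  a.1 ⊆ b.1 ∧ b.2.1 ∩ a.1 = a.2.1 ∧ ∀ z ∈ a.1, b.2.2 z = a.2.2 z

theorem exists_upper_bound (hU : Unhindered D X r) (c : Set (Set V × Set V × (V → V)))
    (hcoh : ∀ a ∈ c, Coherent D X r S a.1 a.2.1 a.2.2)
    (hc : ∀ a ∈ c, ∀ b ∈ c, Le a b ∨ Le b a) :
    ∃ b : Set V × Set V × (V → V), Coherent D X r S b.1 b.2.1 b.2.2 ∧ ∀ a ∈ c, Le a b := by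
  classical
  have hex : ∀ z : V, ∃ l : V, ∀ a ∈ c, z ∈ a.1 → a.2.2 z = l := by
    intro z
    by_cases hz : ∃ a ∈ c, z ∈ a.1
    · obtain ⟨a, ha, hza⟩ := hz
      refine ⟨a.2.2 z, fun b hb hzb => ?_⟩
      rcases hc a ha b hb with h | h
      exacts [h.2.2 z hza, (h.2.2 z hzb).symm]
    · exact ⟨z, fun a ha hza => absurd ⟨a, ha, hza⟩ hz⟩
  choose L hL using hex
  let U : Set V := ⋃ a ∈ c, a.1
  let Y : Set V := ⋃ a ∈ c, a.2.1
  have hUmem : ∀ z, z ∈ U ↔ ∃ a ∈ c, z ∈ a.1 := by intro z; simp [U]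
  have hYmem : ∀ z, z ∈ Y ↔ ∃ a ∈ c, z ∈ a.2.1 := by intro z; simp [Y]
  have hYU : ∀ a ∈ c, Y ∩ a.1 = a.2.1 := by
    intro a ha
    refine Set.Subset.antisymm ?_ fun y hy => ⟨(hYmem y).2 ⟨a, ha, hy⟩, (hcoh a ha).sub hy⟩
    rintro y ⟨hy, hya⟩
    obtain ⟨b, hb, hyb⟩ := (hYmem y).1 hy
    rcases hc a ha b hb with h | h
    · rw [← h.2.1]; exact ⟨hyb, hya⟩
    · rw [← h.2.1] at hyb; exact hyb.1
  have hsub : ∀ a ∈ c, a.1 ⊆ U := fun a ha z hz => (hUmem z).2 ⟨a, ha, hz⟩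
  have hnT : ∀ a ∈ c, ∀ z ∈ a.1, z ∉ X ∪ Y → z ∉ X ∪ a.2.1 := by
    rintro a ha z hz hzT (hh | hh)
    exacts [hzT (Or.inl hh), hzT (Or.inr ((hYmem z).2 ⟨a, ha, hh⟩))]
  have htwo : ∀ z ∈ U, ∀ z' ∈ U, ∃ a ∈ c, z ∈ a.1 ∧ z' ∈ a.1 := by
    intro z hz z' hz'
    obtain ⟨a, ha, hza⟩ := (hUmem z).1 hz
    obtain ⟨b, hb, hzb⟩ := (hUmem z').1 hz'
    rcases hc a ha b hb with h | h
    exacts [⟨b, hb, h.1 hza, hzb⟩, ⟨a, ha, hza, h.1 hzb⟩]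
  refine ⟨(U, Y, L), ⟨?_, ?_, ?_, ?_, ⟨?_, ?_, ?_, ?_, ?_⟩, ?_, ?_⟩,
    fun a ha => ⟨hsub a ha, hYU a ha, fun z hz => (hL z a ha hz).symm⟩⟩
  · intro hh
    obtain ⟨a, ha, h⟩ := (hUmem r).1 hh
    exact (hcoh a ha).root h
  · intro y hy
    obtain ⟨a, ha, h⟩ := (hYmem y).1 hy
    exact hsub a ha ((hcoh a ha).sub h)
  · intro y hy
    obtain ⟨a, ha, h⟩ := (hYmem y).1 hy
    exact (hcoh a ha).subS h
  · intro y hy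
    obtain ⟨a, ha, h⟩ := (hYmem y).1 hy
    exact (hcoh a ha).disj y h
  · intro z hz hzT
    obtain ⟨a, ha, hza⟩ := (hUmem z).1 hz
    have := (hcoh a ha).link.maps z hza (hnT a ha z hza hzT)
    rw [hL z a ha hza] at this
    exact hsub a ha this
  · intro z hz hzT
    obtain ⟨a, ha, hza⟩ := (hUmem z).1 hz
    have := (hcoh a ha).link.edge z hza (hnT a ha z hza hzT)
    rwa [hL z a ha hza] at this
  · intro z hz hzT
    obtain ⟨a, ha, hza⟩ := (hUmem z).1 hz
    have h1 := (hcoh a ha).link.maps z hza (hnT a ha z hza hzT)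
    have h2 := (hcoh a ha).link.avoid z hza (hnT a ha z hza hzT)
    rw [hL z a ha hza] at h1 h2
    rintro ⟨_, q, hq, hqz⟩
    exact h2 ⟨h1, q, fun hh => hq (hsub a ha hh), hqz⟩
  · intro z hz hzT z' hz' hzT' he
    obtain ⟨a, ha, hza, hza'⟩ := htwo z hz z' hz'
    have he' : L z = L z' := he
    rw [← hL z a ha hza, ← hL z' a ha hza'] at he'
    exact (hcoh a ha).link.inj z hza (hnT a ha z hza hzT) z' hza' (hnT a ha z' hza' hzT') he'
  · intro z hz
    obtain ⟨a, ha, hza⟩ := (hUmem z).1 hz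
    obtain ⟨F, h1, h2, h3, h4⟩ := (hcoh a ha).link.fin z hza
    refine ⟨F, h1, h2, h3.trans (hsub a ha), fun w hw hwT => ?_⟩
    have := h4 w hw (hnT a ha w (h3 hw) hwT)
    rwa [hL w a ha (h3 hw)] at this
  · intro Y0 hY0 hf
    have : Y0 = ∅ ∨ ∃ a ∈ c, Y0 ⊆ a.2.1 := by
      induction Y0, hf using Set.Finite.induction_on with
      | empty => exact Or.inl rfl
      | @insert y F _ _ ih =>
        obtain ⟨a, ha, hya⟩ := (hYmem y).1 (hY0 (Or.inl rfl))
        rcases ih fun x hx => hY0 (Or.inr hx) with rfl | ⟨b, hb, hFb⟩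
        · exact Or.inr ⟨a, ha, by simpa using hya⟩
        · rcases hc a ha b hb with h | h
          · refine Or.inr ⟨b, hb, Set.insert_subset ?_ hFb⟩
            rw [← h.2.1] at hya; exact hya.1
          · refine Or.inr ⟨a, ha, Set.insert_subset hya fun x hx => ?_⟩
            have := hFb hx
            rw [← h.2.1] at this; exact this.1
    rcases this with rfl | ⟨a, ha, hYa⟩
    · simpa using hU
    · exact (hcoh a ha).unh Y0 hYa hf
  · intro z hz
    obtain ⟨a, ha, hza⟩ := (hUmem z).1 hz
    obtain ⟨B, hzB, h1, h2, h3⟩ := (hcoh a ha).good z hza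
    refine ⟨B, hzB, h1.trans (hsub a ha), h2.subset ?_, fun w hw hwX => ?_⟩
    · rw [← hYU a ha]
      exact fun y hy => ⟨⟨hy.1, h1 hy.2⟩, hy.2⟩
    · have := h3 w hw (hnT a ha w (h1 hw) hwX)
      rwa [hL w a ha (h1 hw)] at this

theorem exists_covering (hU : Unhindered D X r) (hr : r ∉ S) :
    ∃ U Y L, Coherent D X r S U Y L ∧ S ⊆ U := by
  let α := {a : Set V × Set V × (V → V) // Coherent D X r S a.1 a.2.1 a.2.2}
  obtain ⟨⟨m, hm⟩, hmax⟩ := exists_maximal_of_chains_bounded (α := α)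
    (r := fun a b => Le a.1 b.1) (by
      intro c hc
      obtain ⟨b, hb, hub⟩ := exists_upper_bound (S := S) hU (Subtype.val '' c)
        (by rintro _ ⟨a, -, rfl⟩; exact a.2)
        (by
          rintro _ ⟨a, ha, rfl⟩ _ ⟨b, hb, rfl⟩
          by_cases hab : a = b
          · subst hab
            exact Or.inl ⟨subset_rfl, Set.inter_eq_left.2 a.2.sub, fun _ _ => rfl⟩
          · exact hc ha hb hab)
      exact ⟨⟨b, hb⟩, fun a ha => hub _ ⟨a, ha, rfl⟩⟩)
    (by
      intro a b c h1 h2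
      refine ⟨h1.1.trans h2.1, ?_, fun z hz => (h2.2.2 z (h1.1 hz)).trans (h1.2.2 z hz)⟩
      rw [← h1.2.1, ← h2.2.1, Set.inter_assoc, Set.inter_eq_self_of_subset_right h1.1])
  refine ⟨m.1, m.2.1, m.2.2, hm, fun s hs => ?_⟩
  by_contra hsU
  have hsr : r ≠ s := fun he => hr (he ▸ hs)
  by_cases hex : ∃ Y0 ⊆ m.2.1, Y0.Finite ∧ ∃ C, IsWave D (X ∪ Y0) r C ∧ s ∈ C
  · obtain ⟨Y0, hY0, hf, C, hC, hsC⟩ := hex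
    obtain ⟨L', hL', hcoh⟩ := hm.add_wave hY0 hf hC
    have := hmax ⟨(m.1 ∪ C, m.2.1, L'), hcoh⟩
      ⟨Set.subset_union_left, Set.inter_eq_left.2 hm.sub, hL'⟩
    exact hsU (this.1 (Or.inr hsC))
  · push Not at hex
    have hcoh := hm.add_vertex hs hsU hsr hex
    have := hmax ⟨(insert s m.1, insert s m.2.1, m.2.2), hcoh⟩
      ⟨Set.subset_insert _ _, ?_, fun _ _ => rfl⟩
    · exact hsU (this.1 (Or.inl rfl))
    · ext y
      constructor
      · rintro ⟨rfl | hy, hyU⟩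
        exacts [absurd hyU hsU, hy]
      · exact fun hy => ⟨Or.inr hy, hm.sub hy⟩

end Coherent

end

section

variable {D : Set (V × V)} {X : Set V} {r : V}

namespace Coherent

variable {S U Y : Set V} {L : V → V}

/-- The vertices on the paths of the linkage that start in the entrance and end in `Y`. -/
def chainSet (D : Set (V × V)) (X U Y : Set V) (L : V → V) : Set V :=
  {x | ∃ e ∈ entrance D U, ∃ n, (∀ j < n, L^[j] e ∉ X ∪ Y) ∧ L^[n] e ∈ Y ∧ ∃ i ≤ n, x = L^[i] e}

theorem ne_entrance (h : Coherent D X r S U Y L) {e : V} (he : e ∈ entrance D U) :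
    ∀ z ∈ U, z ∉ X ∪ Y → L z ≠ e := fun z hz hzT hh => h.link.avoid z hz hzT (hh ▸ he)

theorem chainSet_subset (h : Coherent D X r S U Y L) : chainSet D X U Y L ⊆ U := by
  rintro x ⟨e, he, n, hn, -, i, hi, rfl⟩
  exact h.link.mem_iter he.1 i fun j hj => hn j (by omega)

theorem chainSet_notMem (h : Coherent D X r S U Y L) {x : V} (hx : x ∈ chainSet D X U Y L) :
    x ∉ X := by
  obtain ⟨e, he, n, hn, hy, i, hi, rfl⟩ := hx
  rcases hi.lt_or_eq with hi | rfl
  exacts [fun hh => hn i hi (Or.inl hh), h.disj _ hy]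

theorem chainSet_head (h : Coherent D X r S U Y L) {x : V} (hx : x ∈ chainSet D X U Y L) :
    ∃ q, (q, x) ∈ D := by
  obtain ⟨e, he, n, hn, hy, i, hi, rfl⟩ := hx
  induction i with
  | zero =>
    obtain ⟨-, q, -, hq⟩ := he
    exact ⟨q, hq⟩
  | succ i ih =>
    rw [Function.iterate_succ_apply']
    rcases h.link.edge _ (h.link.mem_iter he.1 i fun j hj => hn j (by omega)) (hn i (by omega))
      with h' | h'
    · rw [h']; exact ih (by omega)
    · exact ⟨_, h'⟩

theorem chainSet_reach (h : Coherent D X r S U Y L) {x : V} (hx : x ∈ chainSet D X U Y L) :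
    ∃ y ∈ Y, y ∈ chainSet D X U Y L ∧
      Relation.ReflTransGen (fun a b => (a, b) ∈ D ∧ b ∈ chainSet D X U Y L) x y := by
  obtain ⟨e, he, n, hn, hy, i, hi, rfl⟩ := hx
  have hmem : ∀ i ≤ n, L^[i] e ∈ chainSet D X U Y L := fun i hi => ⟨e, he, n, hn, hy, i, hi, rfl⟩
  refine ⟨_, hy, hmem n le_rfl, ?_⟩
  obtain ⟨k, rfl⟩ := Nat.exists_eq_add_of_le hi
  clear hi
  have : ∀ m ≤ k, Relation.ReflTransGen (fun a b => (a, b) ∈ D ∧ b ∈ chainSet D X U Y L)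
      (L^[i] e) (L^[i + m] e) := by
    intro m
    induction m with
    | zero => exact fun _ => .refl
    | succ m ih =>
      intro hm
      have hin := h.link.edge _ (h.link.mem_iter he.1 (i + m) fun j hj => hn j (by omega))
        (hn (i + m) (by omega))
      have hm' := hmem (i + (m + 1)) (by omega)
      rw [← add_assoc, Function.iterate_succ_apply'] at hm' ⊢
      rcases hin with h' | h'
      · rw [h']; exact ih (by omega)
      · exact (ih (by omega)).tail ⟨h', hm'⟩
  exact this k le_rfl

theorem chainSet_closure {K : Set V} (hf : K.Finite) (hK : K ⊆ chainSet D X U Y L) :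
    ∃ R, R.Finite ∧ K ⊆ R ∧ R ⊆ chainSet D X U Y L ∧ ∀ z ∈ R, z ∉ X ∪ Y → L z ∈ R := by
  have hK' : ∀ x ∈ K, ∃ e ∈ entrance D U, ∃ n, (∀ j < n, L^[j] e ∉ X ∪ Y) ∧ L^[n] e ∈ Y ∧
    ∃ i ≤ n, x = L^[i] e := fun x hx => hK hx
  choose! e he n hn hy i hi hx using hK'
  refine ⟨⋃ x ∈ K, (fun i => L^[i] (e x)) '' Set.Iic (n x),
    hf.biUnion fun x _ => (Set.finite_Iic _).image _, ?_, ?_, ?_⟩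
  · exact fun x h => Set.mem_biUnion h ⟨i x, hi x h, (hx x h).symm⟩
  · intro z hz
    simp only [Set.mem_iUnion] at hz
    obtain ⟨x, h, j, hj, rfl⟩ := hz
    exact ⟨e x, he x h, n x, hn x h, hy x h, j, hj, rfl⟩
  · intro z hz hzT
    simp only [Set.mem_iUnion] at hz
    obtain ⟨x, h, j, hj, rfl⟩ := hz
    refine Set.mem_biUnion h ⟨j + 1, ?_, Function.iterate_succ_apply' _ _ _⟩
    have : j ≤ n x := hj
    rcases this.lt_or_eq with hlt | rfl
    · exact hlt
    · exact absurd (Or.inr (hy x h)) hzT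

theorem finite_inter_wave (h : Coherent D X r S U Y L) {F W : Set V} (hF : F.Finite)
    (hW : IsWave D (X ∪ F) r W) : (chainSet D X U Y L ∩ W).Finite := by
  classical
  by_contra hinf
  let E0 : Set V := {e | e ∈ entrance D U ∧ ∃ n, (∀ j < n, L^[j] e ∉ X ∪ Y) ∧ L^[n] e ∈ Y ∧
    ∃ i ≤ n, L^[i] e ∈ W}
  have hE0 : ∀ e ∈ E0, ∃ n, (∀ j < n, L^[j] e ∉ X ∪ Y) ∧ L^[n] e ∈ Y ∧
    ∃ i ≤ n, L^[i] e ∈ W := fun e he => he.2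
  choose! n hn hy i hi hiW using hE0
  have hE0inf : E0.Infinite := by
    intro hfin
    refine hinf ((hfin.biUnion fun e _ => (Set.finite_Iic (n e)).image
      (fun i => L^[i] e)).subset ?_)
    rintro x ⟨⟨e, he, m, hm, hmy, j, hj, rfl⟩, hxW⟩
    have heE : e ∈ E0 := ⟨he, m, hm, hmy, j, hj, hxW⟩
    refine Set.mem_biUnion heE ⟨j, ?_, rfl⟩
    have : m ≤ n e := by
      by_contra hlt
      exact hm (n e) (by omega) (Or.inr (hy e heE))
    exact hj.trans this
  have hinjY : Set.InjOn (fun e => L^[n e] e) E0 := fun e he e' he' hee =>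
    (h.link.orbit_unique he.1.1 he'.1.1 (h.ne_entrance he.1) (h.ne_entrance he'.1) _ _
      (hn e he) (hn e' he') hee).2
  have hfinF : (E0 ∩ (fun e => L^[n e] e) ⁻¹' F).Finite := by
    refine Set.Finite.of_finite_image (hF.subset ?_) (hinjY.mono Set.inter_subset_left)
    rintro _ ⟨e, he, rfl⟩
    exact he.2
  obtain ⟨E1, hE1, hcard⟩ := (hE0inf.sdiff hfinF).exists_subset_card_eq (hF.toFinset.card + 1)
  have hE1' : ∀ e ∈ E1, e ∈ E0 := fun e he => (hE1 he).1
  let Y1 : Finset V := E1.image fun e => L^[n e] e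
  have hY1card : Y1.card = hF.toFinset.card + 1 := by
    rw [← hcard]
    exact Finset.card_image_of_injOn (hinjY.mono hE1')
  obtain ⟨B, hB, hG⟩ := h.good_finite (F := ⋃ e ∈ E1, (fun i => L^[i] e) '' Set.Iic (n e))
    (E1.finite_toSet.biUnion fun e _ => (Set.finite_Iic _).image _) (by
      intro z hz
      simp only [Set.mem_iUnion] at hz
      obtain ⟨e, he, j, hj, rfl⟩ := hz
      have hj' : j ≤ n e := hj
      exact h.link.mem_iter (hE1' e he).1.1 j fun k hk => hn e (hE1' e he) k (by omega))
  have hchB : ∀ e ∈ E1, ∀ j ≤ n e, L^[j] e ∈ B := fun e he j hj =>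
    hB (Set.mem_biUnion he ⟨j, hj, rfl⟩)
  have hY1B : ∀ y ∈ Y1, y ∈ Y ∩ B := by
    intro y hyy
    obtain ⟨e, he, rfl⟩ := Finset.mem_image.1 hyy
    exact ⟨hy e (hE1' e he), hchB e he _ le_rfl⟩
  let T : Set V := X ∪ (Y ∩ B) \ Y1
  let O : Set V := {w | ∃ e ∈ E1, ∃ j ≤ n e, w = L^[j] e ∧ ∃ k < j, L^[k] e ∈ W}
  have hTF : T ∪ ↑hF.toFinset = X ∪ F ∪ (Y ∩ B) \ Y1 := by
    simp only [T, Set.Finite.coe_toFinset]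
    rw [Set.union_right_comm]
  obtain ⟨hr, σ, hσ⟩ := hW
  have hL := h.link_good hG
  have hbad : ∀ z ∈ B, z ∈ X ∪ Y → z ∉ T ∪ ↑hF.toFinset ∪ W → z ∈ O := by
    intro z hz hzX hzT
    have hzY : z ∈ Y := hzX.resolve_left fun hh => hzT (Or.inl (Or.inl (Or.inl hh)))
    have hz1 : z ∈ Y1 := by
      by_contra hh
      exact hzT (Or.inl (Or.inl (Or.inr ⟨⟨hzY, hz⟩, hh⟩)))
    obtain ⟨e, he, rfl⟩ := Finset.mem_image.1 hz1
    refine ⟨e, he, n e, le_rfl, rfl, i e, ?_, hiW e (hE1' e he)⟩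
    rcases (hi e (hE1' e he)).lt_or_eq with hlt | heq
    · exact hlt
    · exact absurd (Or.inr (heq ▸ hiW e (hE1' e he))) hzT
  obtain ⟨σ2, h2⟩ : ∃ σ2, Linkage D B (T ∪ ↑hF.toFinset ∪ W) (entrance D B) σ2 := by
    refine ⟨_, hL.freeze hbad ?_ ?_⟩
    · rintro _ ⟨e, he, j, hj, rfl, k, hk, hkW⟩ - -
      obtain ⟨j, rfl⟩ : ∃ j', j = j' + 1 := ⟨j - 1, by omega⟩
      rw [Function.iterate_succ_apply']
      exact hL.avoid _ (hchB e he j (by omega)) (hn e (hE1' e he) j (by omega))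
    · rintro z hz hzX hzT ⟨e, he, j, hj, hzj, k, hk, hkW⟩ hLT
      obtain ⟨j, rfl⟩ : ∃ j', j = j' + 1 := ⟨j - 1, by omega⟩
      rw [Function.iterate_succ_apply'] at hzj
      have hz' := hL.inj z hz hzX _ (hchB e he j (by omega))
        (hn e (hE1' e he) j (by omega)) hzj
      refine ⟨e, he, j, by omega, hz', k, ?_, hkW⟩
      rcases (Nat.lt_succ_iff.1 hk).lt_or_eq with hlt | rfl
      · exact hlt
      · exact absurd (Or.inr (hz' ▸ hkW)) hzT
  have hwave : IsWave D (T ∪ ↑hF.toFinset) r (W ∪ B) := by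
    refine ⟨?_, ?_⟩
    · rintro (hh | hh)
      exacts [hr hh, h.root (hG.1 hh)]
    · have h1 : Linkage D W (T ∪ ↑hF.toFinset) (entrance D W ∪ ∅) σ := by
        rw [hTF, Set.union_empty]
        exact hσ.mono_target Set.subset_union_left
      have := h1.comb_wave h2 (by
        rintro x hx (⟨_, q, hq, hqx⟩ | hh)
        · exact ⟨hx, q, fun hh => hq (Or.inr hh), hqx⟩
        · exact absurd hh (by simp))
      rw [Set.union_empty] at this
      exact ⟨_, this⟩
  refine hwave.exchange (Y := Y1) (fun y hy => Or.inr (hY1B y hy).2) ?_ (by omega) ?_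
  · rintro y hyy ((hh | hh) | hh)
    · exact h.disj y (hY1B y hyy).1 hh
    · exact hh.2 hyy
    · obtain ⟨e, he, rfl⟩ := Finset.mem_image.1 hyy
      exact (hE1 he).2 ⟨hE1' e he, by simpa using hh⟩
  · refine (h.unh (Y ∩ B) Set.inter_subset_left hG.2.1).anti ?_
    rintro x ((hx | hx) | hx)
    exacts [Or.inl hx, Or.inr hx.1, Or.inr (hY1B x hx)]

theorem unhindered_del (h : Coherent D X r S U Y L) {R : Set V} (hR : R ⊆ chainSet D X U Y L)
    (hf : R.Finite) (hcl : ∀ z ∈ R, z ∉ X ∪ Y → L z ∈ R) : Unhindered (del D R) X r := by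
  classical
  intro W0 t0 hW0
  obtain ⟨W, -, hWR, t, hW⟩ := hW0.del_finite hf fun k hk => h.chainSet_notMem (hR hk)
  rw [del_del, Set.union_self] at hW
  obtain ⟨B, hB, hG⟩ := h.good_finite hf (hR.trans h.chainSet_subset)
  obtain ⟨hr, htW, htX, htE, σ, hσ⟩ := hW
  have htW : t ∈ W := htW rfl
  have htX : t ∈ X := htX rfl
  have htE := htE t rfl
  have hL := h.link_good hG
  have hT : ∀ w ∈ B, w ∉ X ∪ (Y ∩ B) → w ∉ X ∪ Y := by
    rintro w hw hwT (hh | hh)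
    exacts [hwT (Or.inl hh), hwT (Or.inr ⟨hh, hw⟩)]
  have hE : ∀ x ∈ W, x ∈ entrance D (W ∪ B) → x ∈ entrance (del D R) W := by
    rintro x hx ⟨_, q, hq, hqx⟩
    exact ⟨hx, q, fun hh => hq (Or.inl hh), hqx, fun hh => hq (Or.inr (hB hh)),
      fun hh => hWR x hh hx⟩
  have hstep : ∀ z ∈ B, z ∉ W → z ∉ X ∪ (Y ∩ B) → L z ∈ W → L z ∈ entrance (del D R) W := by
    intro z hz hzW hzT hLW
    have hzT' := hT z hz hzT
    have hzR : z ∉ R := fun hh => hWR _ (hcl z hh hzT') hLW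
    rcases hL.edge z hz hzT' with h' | h'
    · exact absurd (h' ▸ hLW) hzW
    · exact ⟨hLW, z, hzW, h', hzR, fun hh => hWR _ hh hLW⟩
  have h1 : Linkage D W (X ∪ (Y ∩ B)) (entrance D (W ∪ B) ∪ {t}) σ := by
    refine ((hσ.avoid_of ?_).graph fun _ _ _ h => h.1).mono_target Set.subset_union_left
    exact fun x hx hxW => hx.imp (hE x hxW) id
  have h2 : Linkage D B (X ∪ (Y ∩ B) ∪ W) (entrance D (W ∪ B) ∪ {t}) L := by
    have hL' : Linkage D B (X ∪ (Y ∩ B) ∪ W) (entrance D B) L := hL.mono_target_of_inter (by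
      rintro x ⟨hx | hx, hxB⟩
      exacts [Or.inl (Or.inl hx), Or.inl (Or.inr ⟨hx, hxB⟩)])
    refine ⟨hL'.maps, hL'.edge, ?_, hL'.inj, hL'.fin⟩
    rintro z hz hzT (⟨_, q, hq, hqz⟩ | hh)
    · exact hL'.avoid z hz hzT ⟨hL'.maps z hz hzT, q, fun hh => hq (Or.inr hh), hqz⟩
    · have hh' : L z = t := hh
      have := hstep z hz (fun hh => hzT (Or.inr hh)) (fun hh => hzT (Or.inl hh)) (hh' ▸ htW)
      exact htE (hh' ▸ this)
  have h3 := h1.comb h2 (by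
    intro z hz hzT z' hz' hzW hzT' he
    have hm := h1.maps z hz hzT
    have := hstep z' hz' hzW hzT' (he ▸ hm)
    rw [← he] at this
    exact hσ.avoid z hz (fun hh => hzT (Or.inl hh)) (Or.inl this))
  refine h.unh (Y ∩ B) Set.inter_subset_left hG.2.1 (W ∪ B) t ⟨?_, ?_, ?_, ?_, _, h3⟩
  · rintro (hh | hh)
    exacts [hr hh, h.root (hG.1 hh)]
  · rintro _ rfl; exact Or.inl htW
  · rintro _ rfl; exact Or.inl htX
  · rintro _ rfl hh; exact htE (hE _ htW hh)

end Coherent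

end

section

variable {D : Set (V × V)} {T K Z S U Y : Set V} {L : V → V} {r : V}

theorem Unhindered.no_stray {σ : V → V} (h : Unhindered D T r) (hr : r ∉ Z)
    (hσ : Linkage D Z T (entrance D Z) σ) {p : V} (hp : p ∈ Z) :
    p ∈ entrance D Z ∨ ∃ z ∈ Z, z ∉ T ∧ σ z = p := by
  by_contra! hcon
  obtain ⟨t, htT, htZ, htE, σ', hσ'⟩ := hσ.stray hp hcon.1 hcon.2
  refine h Z t ⟨hr, by rintro _ rfl; exact htZ, by rintro _ rfl; exact htT,
    by rintro _ rfl; exact htE, σ', hσ'.avoid_of fun x hx _ => ?_⟩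
  rcases hx with hx | rfl
  exacts [Or.inr hx, Or.inl rfl]

open Classical in
/-- A wave can be pushed beyond a set `Z` by stopping its paths when they meet `Z`. -/
theorem Linkage.push {D₁ Γ : Set (V × V)} {A T₁ X F : Set V} {σ : V → V}
    (h : Linkage D₁ A T₁ (entrance D₁ A) σ) (hT : ∀ z ∈ A, z ∈ T₁ → z ∈ Z ∪ F)
    (hedge : ∀ z ∈ A, z ∉ Z → z ∉ F → (z, σ z) ∈ D₁ → (z, σ z) ∈ Γ)
    (hent : ∀ q p, (q, p) ∈ Γ → p ∈ A → q ∉ A ∪ Z → (q, p) ∈ D₁)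
    (hhead : ∀ q p, (q, p) ∈ Γ → p ∈ Z → p ∈ X) :
    Linkage Γ (A ∪ Z) (X ∪ F) (entrance Γ (A ∪ Z)) (fun z => if z ∈ Z then z else σ z) := by
  have key : ∀ z ∈ A ∪ Z, z ∉ X ∪ F → z ∉ Z →
      z ∈ A ∧ z ∉ T₁ ∧ σ z ∈ A ∧ (σ z = z ∨ (z, σ z) ∈ Γ) := by
    intro z hz hzT hzZ
    have hzA := hz.resolve_right hzZ
    have hzF : z ∉ F := fun hh => hzT (Or.inr hh)
    have hzT₁ : z ∉ T₁ := fun hh => (hT z hzA hh).elim hzZ hzF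
    exact ⟨hzA, hzT₁, h.maps z hzA hzT₁, (h.edge z hzA hzT₁).imp_right (hedge z hzA hzZ hzF)⟩
  have mixed : ∀ z ∈ A ∪ Z, z ∉ X ∪ F → z ∉ Z → ∀ y ∈ Z, y ∉ X → σ z ≠ y := by
    rintro z hz hzT hzZ y hy hyX rfl
    obtain ⟨-, -, -, h' | h'⟩ := key z hz hzT hzZ
    · exact hzZ (h' ▸ hy)
    · exact hyX (hhead _ _ h' hy)
  refine ⟨?_, ?_, ?_, ?_, ?_⟩
  · intro z hz hzT
    by_cases hzZ : z ∈ Z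
    · simpa only [hzZ, if_true] using hz
    · simp only [hzZ, if_false]
      exact Or.inl (key z hz hzT hzZ).2.2.1
  · intro z hz hzT
    by_cases hzZ : z ∈ Z
    · simp only [hzZ, if_true, true_or]
    · simpa only [hzZ, if_false] using (key z hz hzT hzZ).2.2.2
  · intro z hz hzT
    by_cases hzZ : z ∈ Z
    · simp only [hzZ, if_true]
      rintro ⟨-, q, -, hqz⟩
      exact hzT (Or.inl (hhead q z hqz hzZ))
    · simp only [hzZ, if_false]
      rintro ⟨-, q, hq, hqz⟩
      obtain ⟨h1, h2, h3, -⟩ := key z hz hzT hzZ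
      exact h.avoid z h1 h2 ⟨h3, q, fun hh => hq (Or.inl hh), hent q _ hqz h3 hq⟩
  · intro z hz hzT z' hz' hzT' he
    by_cases hzZ : z ∈ Z <;> by_cases hzZ' : z' ∈ Z <;>
      simp only [hzZ, hzZ', if_true, if_false] at he
    · exact he
    · exact absurd he.symm (mixed z' hz' hzT' hzZ' z hzZ fun hh => hzT (Or.inl hh))
    · exact absurd he (mixed z hz hzT hzZ z' hzZ' fun hh => hzT' (Or.inl hh))
    · obtain ⟨h1, h2, -⟩ := key z hz hzT hzZ
      obtain ⟨h1', h2', -⟩ := key z' hz' hzT' hzZ'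
      exact h.inj z h1 h2 z' h1' h2' he
  · intro z hz
    by_cases hzZ : z ∈ Z
    · refine ⟨{z}, Set.finite_singleton z, rfl, by simpa using hz, ?_⟩
      rintro _ rfl -
      simp [hzZ]
    · obtain ⟨F₀, h1, h2, h3, h4⟩ := h.fin z (hz.resolve_right hzZ)
      refine ⟨F₀, h1, h2, h3.trans Set.subset_union_left, fun w hw hwT => ?_⟩
      by_cases hwZ : w ∈ Z
      · simpa only [hwZ, if_true] using hw
      · simpa only [hwZ, if_false] using h4 w hw (key w (Or.inl (h3 hw)) hwT hwZ).2.1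

/-- A set of vertices that can be deleted without creating a hindrance, at least in finite parts,
and that no wave towards `T` and finitely many further vertices meets infinitely often. -/
structure Nice (D : Set (V × V)) (T : Set V) (r : V) (K : Set V) : Prop where
  root : r ∉ K
  disj : ∀ k ∈ K, k ∉ T
  unh : ∀ K₁ ⊆ K, K₁.Finite → Unhindered (del D K₁) T r
  fin : ∀ F : Set V, F.Finite → ∀ A, IsWave D (T ∪ F) r A → (A ∩ K).Finite

theorem Unhindered.nice_empty (h : Unhindered D T r) : Nice D T r ∅ where
  root := by simp
  disj := by simp
  unh K₁ hK _ := by rwa [Set.subset_empty_iff.1 hK, del_empty]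
  fin := by simp

/-- The digraph behind the largest wave after deleting `K`. -/
def behind (D : Set (V × V)) (T : Set V) (r : V) (K : Set V) : Set (V × V) :=
  outside (del D K) (maxWave (del D K) T r)

/-- The entrance of the largest wave after deleting `K`. -/
def front (D : Set (V × V)) (T : Set V) (r : V) (K : Set V) : Set V :=
  entrance (del D K) (maxWave (del D K) T r)

theorem front_subset : front D T r K ⊆ maxWave (del D K) T r := fun _ h => h.1

theorem head_mem_front {q p : V} (h : (q, p) ∈ behind D T r K)
    (hp : p ∈ maxWave (del D K) T r) : p ∈ front D T r K :=
  ⟨hp, q, h.2, h.1⟩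

/-- The part of the chains of a covering behind the largest wave. -/
def chains (D : Set (V × V)) (T : Set V) (r : V) (K U Y : Set V) (L : V → V) : Set V :=
  Coherent.chainSet (behind D T r K) (front D T r K) U Y L

namespace Coherent

theorem chains_notMem (h : Coherent (behind D T r K) (front D T r K) r S U Y L) {x : V}
    (hx : x ∈ chains D T r K U Y L) : x ∉ maxWave (del D K) T r := by
  intro hxZ
  obtain ⟨q, hq⟩ := h.chainSet_head hx
  exact h.chainSet_notMem hx (head_mem_front hq hxZ)

theorem isWave_union (h : Coherent (behind D T r K) (front D T r K) r S U Y L) :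
    IsWave (del D (K ∪ chains D T r K U Y L)) T r (maxWave (del D K) T r ∪ U) := by
  classical
  set R := chains D T r K U Y L with hR
  set Z := maxWave (del D K) T r with hZ
  have hRZ : ∀ x ∈ R, x ∉ Z := fun x hx => h.chains_notMem hx
  have hdel : ∀ e ∈ del D K, e.1 ∉ R → e.2 ∉ R → e ∈ del D (K ∪ R) :=
    fun e he h1 h2 => ⟨he.1, fun hh => hh.elim he.2.1 h1, fun hh => hh.elim he.2.2 h2⟩
  have hdel' : ∀ e ∈ del D (K ∪ R), e ∈ del D K ∧ e.1 ∉ R ∧ e.2 ∉ R :=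
    fun e he => ⟨⟨he.1, fun hh => he.2.1 (Or.inl hh), fun hh => he.2.2 (Or.inl hh)⟩,
      fun hh => he.2.1 (Or.inr hh), fun hh => he.2.2 (Or.inr hh)⟩
  obtain ⟨hr, s, hs⟩ := isWave_maxWave (del D K) T r
  rw [← hZ] at hs hr
  have h1 : Linkage (del D (K ∪ R)) Z T (entrance (del D (K ∪ R)) Z ∪ ∅) s := by
    refine (hs.graph fun z hz hzT hh => hdel _ hh (fun hx => hRZ _ hx hz)
      fun hx => hRZ _ hx (hs.maps z hz hzT)).avoid_of ?_
    rintro x (⟨hx, q, hq, hqx⟩ | hx) -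
    · exact ⟨hx, q, hq, (hdel' _ hqx).1⟩
    · exact absurd hx (by simp)
  let O : Set V := {z | ∃ n, (∀ j < n, L^[j] z ∉ front D T r K ∪ Y) ∧ L^[n] z ∈ Y}
  have hRO : ∀ x ∈ R, x ∈ O := by
    rintro x ⟨e, he, n, hn, hy, i, hi, rfl⟩
    refine ⟨n - i, fun j hj => ?_, ?_⟩
    · rw [← Function.iterate_add_apply]; exact hn _ (by omega)
    · rw [← Function.iterate_add_apply, Nat.sub_add_cancel hi]; exact hy
  have hentr : ∀ x ∈ entrance (del D (K ∪ R)) (Z ∪ U), x ∈ U → x ∈ entrance (behind D T r K) U := by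
    rintro x ⟨-, q, hq, hqx⟩ hxU
    exact ⟨hxU, q, fun hh => hq (Or.inr hh), (hdel' _ hqx).1, fun hh => hq (Or.inl hh)⟩
  have hpred : ∀ z, z ∉ front D T r K ∪ Y → L z ∈ O → z ∈ O := by
    rintro z hz ⟨n, hn, hy⟩
    refine ⟨n + 1, fun j hj => ?_, hy⟩
    cases j with
    | zero => exact hz
    | succ j => exact hn j (by omega)
  have hYO : ∀ z ∈ Y, z ∈ O := fun z hz => ⟨0, by simp, hz⟩
  have hX : ∀ z, z ∉ T ∪ Z → z ∉ O → z ∉ front D T r K ∪ Y := by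
    rintro z hz hzO (hh | hh)
    · exact hz (Or.inr (front_subset hh))
    · exact hzO (hYO z hh)
  obtain ⟨σ₂, h2⟩ : ∃ σ₂, Linkage (del D (K ∪ R)) U (T ∪ Z)
      (entrance (del D (K ∪ R)) (Z ∪ U)) σ₂ := by
    have hf := (h.link.avoid_of hentr).freeze (T' := T ∪ Z) (O := O) ?_ ?_ ?_
    · refine ⟨_, hf.maps, ?_, hf.avoid, hf.inj, hf.fin⟩
      intro z hz hzT
      by_cases hzO : z ∈ O
      · simp only [hzO, if_true, true_or]
      · simp only [hzO, if_false]
        have hzX := hX z hzT hzO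
        refine (h.link.edge z hz hzX).imp_right fun hh => hdel _ hh.1 (fun hh => hzO (hRO z hh))
          fun hh => hzO (hpred z hzX (hRO _ hh))
    · rintro z hz (hzX | hzY) hzT
      · exact absurd (Or.inr (front_subset hzX)) hzT
      · exact hYO z hzY
    · rintro z ⟨n, hn, hy⟩ hzU - hzE
      have hzR : z ∈ R := ⟨z, hentr z hzE hzU, n, hn, hy, 0, by simp, rfl⟩
      obtain ⟨-, q, -, hq⟩ := hzE
      exact (hdel' _ hq).2.2 hzR
    · exact fun z hz hzX _ hO _ => hpred z hzX hO
  have := h1.comb_wave h2 (by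
    rintro x - (hx | hx)
    · exact hx
    · exact absurd hx (by simp))
  rw [Set.union_empty] at this
  refine ⟨?_, _, this⟩
  rintro (hh | hh)
  exacts [hr hh, h.root hh]

theorem chains_inter_finite (h : Coherent (behind D T r K) (front D T r K) r S U Y L)
    (hN : Nice D T r K) (hrT : r ∉ T) {F A : Set V} (hF : F.Finite)
    (hA : IsWave D (T ∪ F) r A) : (A ∩ chains D T r K U Y L).Finite := by
  classical
  have hAK := hN.fin F hF A hA
  obtain ⟨hr, σ, hσ⟩ := hA
  set Z := maxWave (del D K) T r with hZ
  have hTZ : T ⊆ Z := target_subset_maxWave hrT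
  have hpre : {z ∈ A | z ∉ T ∪ F ∧ σ z ∈ A ∩ K}.Finite := by
    refine Set.Finite.of_finite_image (f := σ) (hAK.subset ?_) ?_
    · rintro _ ⟨z, hz, rfl⟩; exact hz.2.2
    · exact fun z hz z' hz' he => hσ.inj z hz.1 hz.2.1 z' hz'.1 hz'.2.1 he
  let F' := F ∪ (A ∩ K) ∪ {z ∈ A | z ∉ T ∪ F ∧ σ z ∈ A ∩ K}
  have hp := hσ.push (Z := Z) (F := F') (Γ := behind D T r K) (X := front D T r K) ?_ ?_
    (fun q p hqp _ _ => hqp.1.1) (fun q p hqp hp => head_mem_front hqp hp)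
  · have := h.finite_inter_wave (F := F') ((hF.union hAK).union hpre) (W := A ∪ Z) ⟨?_, _, hp⟩
    · exact this.subset fun x hx => ⟨hx.2, Or.inl hx.1⟩
    · rintro (hh | hh)
      exacts [hr hh, root_notMem_maxWave hh]
  · rintro z - (hz | hz)
    exacts [Or.inl (hTZ hz), Or.inr (Or.inl (Or.inl hz))]
  · intro z hz hzZ hzF hzD
    have hzT : z ∉ T ∪ F := by
      rintro (hh | hh)
      exacts [hzZ (hTZ hh), hzF (Or.inl (Or.inl hh))]
    exact ⟨⟨hzD, fun hh => hzF (Or.inl (Or.inr ⟨hz, hh⟩)),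
      fun hh => hzF (Or.inr ⟨hz, hzT, hσ.maps z hz hzT, hh⟩)⟩, hzZ⟩

theorem not_isHind_del (h : Coherent (behind D T r K) (front D T r K) r S U Y L)
    (hN : Nice D T r K) (hrT : r ∉ T) {K₂ R A : Set V} {t : V} (hK₂ : K₂ ⊆ K) (hK₂f : K₂.Finite)
    (hR : R ⊆ chains D T r K U Y L) (hRf : R.Finite)
    (hcl : ∀ z ∈ R, z ∉ front D T r K ∪ Y → L z ∈ R) (hAK : ∀ a ∈ A, a ∉ K)
    (hAR : ∀ a ∈ A, a ∉ R) : ¬ IsHind (del D (K₂ ∪ R)) T r A {t} := by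
  classical
  rintro ⟨hr, htA, htT, htE, σ, hσ⟩
  have htA : t ∈ A := htA rfl
  have htT : t ∈ T := htT rfl
  have htE := htE t rfl
  have hU := h.unhindered_del hR hRf hcl
  set Z := maxWave (del D K) T r with hZ
  have hTZ : T ⊆ Z := target_subset_maxWave hrT
  have hKZ : K ⊆ Z := deleted_subset_maxWave hN.root
  have hRZ : ∀ x ∈ R, x ∉ Z := fun x hx => h.chains_notMem (hR hx)
  have hσ' : Linkage (del D (K₂ ∪ R)) A T (entrance (del D (K₂ ∪ R)) A) σ :=
    hσ.avoid_of fun x hx _ => Or.inl hx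
  have hent : ∀ q p, (q, p) ∈ del (behind D T r K) R → (q, p) ∈ del D (K₂ ∪ R) :=
    fun q p hqp => ⟨hqp.1.1.1, fun hh => hh.elim (fun hh => hqp.1.1.2.1 (hK₂ hh)) hqp.2.1,
      fun hh => hh.elim (fun hh => hqp.1.1.2.2 (hK₂ hh)) hqp.2.2⟩
  have hp := hσ'.push (Z := Z) (F := ∅) (Γ := del (behind D T r K) R) (X := front D T r K)
    (fun z _ hzT => Or.inl (hTZ hzT)) (by
      intro z hz hzZ _ hzD
      have hm := hσ.maps z hz fun hh => hzZ (hTZ hh)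
      exact ⟨⟨⟨hzD.1, hAK _ hz, hAK _ hm⟩, hzZ⟩, hAR _ hz, hAR _ hm⟩)
    (fun q p hqp _ _ => hent q p hqp) (fun q p hqp hp => head_mem_front hqp.1 hp)
  rw [Set.union_empty] at hp
  have hrW : r ∉ A ∪ Z := by
    rintro (hh | hh)
    exacts [hr hh, root_notMem_maxWave hh]
  have hno : ∀ p ∈ A, (p ∈ front D T r K ∨ p ∉ Z) →
      p ∈ entrance (del D (K₂ ∪ R)) A ∨ ∃ z ∈ A, z ∉ Z ∧ σ z = p := by
    intro p hpA hpX
    rcases hU.no_stray hrW hp (Or.inl hpA) with ⟨-, q, hq, hqp⟩ | ⟨z, hz, hzX, hzp⟩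
    · exact Or.inl ⟨hpA, q, fun hh => hq (Or.inl hh), hent _ _ hqp⟩
    · by_cases hzZ : z ∈ Z
      · simp only [hzZ, if_true] at hzp
        subst hzp
        exact absurd hzZ (hpX.resolve_left hzX)
      · simp only [hzZ, if_false] at hzp
        exact Or.inr ⟨z, hz.resolve_right hzZ, hzZ, hzp⟩
  have hback : ∀ y ∈ A, y ∈ Z → y ∈ entrance (del D K₂) (A ∩ Z) →
      y ∈ entrance (del D (K₂ ∪ R)) A ∨ ∃ z ∈ A, z ∉ Z ∧ σ z = y := by
    rintro y hyA hyZ ⟨-, q, hq, hqy⟩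
    by_cases hqZ : q ∈ Z
    · exact Or.inl ⟨hyA, q, fun hh => hq ⟨hh, hqZ⟩, hqy.1,
        fun hh => hh.elim hqy.2.1 fun hh => hRZ _ hh hqZ, fun hh => hh.elim hqy.2.2 (hAR y hyA)⟩
    · exact hno y hyA (Or.inl ⟨hyZ, q, hqZ, hqy.1, fun hh => hqZ (hKZ hh), hAK y hyA⟩)
  have hmaps : ∀ z ∈ A ∩ Z, z ∉ T → σ z ∈ Z := by
    intro z hz hzT
    by_contra hcon
    rcases hno (σ z) (hσ.maps z hz.1 hzT) (Or.inr hcon) with hh | ⟨z', hz', hzZ', he⟩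
    · exact hσ.avoid z hz.1 hzT (Or.inl hh)
    · have := hσ.inj z' hz' (fun hh => hzZ' (hTZ hh)) z hz.1 hzT he
      exact hzZ' (this ▸ hz.2)
  refine hN.unh K₂ hK₂ hK₂f (A ∩ Z) t ⟨fun hh => hr hh.1, ?_, ?_, ?_, σ, ?_, ?_, ?_, ?_, ?_⟩
  · rintro _ rfl; exact ⟨htA, hTZ htT⟩
  · rintro _ rfl; exact htT
  · rintro _ rfl hh
    rcases hback _ htA (hTZ htT) hh with hh | ⟨z', hz', hzZ', he⟩
    · exact htE hh
    · exact hσ.avoid z' hz' (fun hh => hzZ' (hTZ hh)) (Or.inr he)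
  · exact fun z hz hzT => ⟨hσ.maps z hz.1 hzT, hmaps z hz hzT⟩
  · exact fun z hz hzT => (hσ.edge z hz.1 hzT).imp_right fun hh => ⟨hh.1,
      fun hx => hh.2.1 (Or.inl hx), fun hx => hh.2.2 (Or.inl hx)⟩
  · rintro z hz hzT (hh | hh)
    · rcases hback _ (hσ.maps z hz.1 hzT) (hmaps z hz hzT) hh with hh | ⟨z', hz', hzZ', he⟩
      · exact hσ.avoid z hz.1 hzT (Or.inl hh)
      · have := hσ.inj z' hz' (fun hh => hzZ' (hTZ hh)) z hz.1 hzT he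
        exact hzZ' (this ▸ hz.2)
    · exact hσ.avoid z hz.1 hzT (Or.inr hh)
  · exact fun z hz hzT z' hz' hzT' => hσ.inj z hz.1 hzT z' hz'.1 hzT'
  · intro z hz
    obtain ⟨F, h1, h2, h3, h4⟩ := hσ.fin z hz.1
    exact ⟨F ∩ Z, h1.subset Set.inter_subset_left, ⟨h2, hz.2⟩, Set.inter_subset_inter_left _ h3,
      fun w hw hwT => ⟨h4 w hw.1 hwT, hmaps w ⟨h3 hw.1, hw.2⟩ hwT⟩⟩

theorem nice_union (h : Coherent (behind D T r K) (front D T r K) r S U Y L)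
    (hN : Nice D T r K) (hrT : r ∉ T) : Nice D T r (K ∪ chains D T r K U Y L) := by
  have hdisj : ∀ k ∈ K ∪ chains D T r K U Y L, k ∉ T := by
    rintro k (hk | hk) hkT
    exacts [hN.disj k hk hkT, h.chains_notMem hk (target_subset_maxWave hrT hkT)]
  have hroot : r ∉ K ∪ chains D T r K U Y L := by
    rintro (hk | hk)
    exacts [hN.root hk, h.root (h.chainSet_subset hk)]
  refine ⟨hroot, hdisj, ?_, ?_⟩
  · intro K₀ hK₀ hf Z₀ t₀ hH
    obtain ⟨R, hRf, hKR, hR, hcl⟩ := chainSet_closure (K := K₀ ∩ chains D T r K U Y L)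
      (hf.subset Set.inter_subset_left) Set.inter_subset_right
    have hK₁ : K₀ ∩ K ∪ R ⊆ K ∪ chains D T r K U Y L :=
      Set.union_subset_union Set.inter_subset_right hR
    have hK₁f : (K₀ ∩ K ∪ R).Finite := (hf.subset Set.inter_subset_left).union hRf
    obtain ⟨A, -, hAK, t, hA⟩ := hH.del_finite hK₁f fun k hk => hdisj k (hK₁ hk)
    have hKK : K₀ ∪ (K₀ ∩ K ∪ R) = K₀ ∩ K ∪ R := by
      refine Set.union_eq_right.2 fun k hk => ?_
      rcases hK₀ hk with hh | hh
      exacts [Or.inl ⟨hk, hh⟩, Or.inr (hKR ⟨hk, hh⟩)]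
    rw [del_del, hKK] at hA
    have hfin := hN.fin _ hK₁f _ (hA.undelete (fun hh => hroot (hK₁ hh)) hAK).isWave
    have hfin' : (A ∩ K).Finite := hfin.subset fun x hx => ⟨Or.inr hx.1, hx.2⟩
    obtain ⟨A', hA'A, hA'K, t', hA'⟩ := hA.del_finite hfin' fun k hk => hN.disj k hk.2
    rw [del_del, Set.union_right_comm] at hA'
    exact h.not_isHind_del hN hrT (Set.union_subset Set.inter_subset_right Set.inter_subset_right)
      ((hf.subset Set.inter_subset_left).union hfin') hR hRf hcl
      (fun a ha haK => hA'K a ⟨hA'A ha, haK⟩ ha) (fun a ha haR => hAK a (Or.inr haR) (hA'A ha)) hA'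
  · intro F hF A hA
    rw [Set.inter_union_distrib_left]
    exact (hN.fin F hF A hA).union (h.chains_inter_finite hN hrT hF hA)

end Coherent

theorem Nice.exists_step (hN : Nice D T r K) (hrT : r ∉ T) (hrS : r ∉ S) :
    ∃ K', K ⊆ K' ∧ Nice D T r K' ∧ S ⊆ maxWave (del D K') T r ∧
      ∀ k ∈ K', k ∉ K → ∃ s ∈ S, s ∈ K' ∧
        Relation.ReflTransGen (fun a b => (a, b) ∈ D ∧ b ∈ K') k s := by
  obtain ⟨U, Y, L, h, hU⟩ := Coherent.exists_covering (S := S \ maxWave (del D K) T r)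
    (unhindered_outside (del D K) T r) fun hh => hrS hh.1
  refine ⟨K ∪ chains D T r K U Y L, Set.subset_union_left, Coherent.nice_union h hN hrT,
    fun s hs => ?_, ?_⟩
  · refine (Coherent.isWave_union h).subset_maxWave ?_
    by_cases hsZ : s ∈ maxWave (del D K) T r
    exacts [Or.inl hsZ, Or.inr (hU ⟨hs, hsZ⟩)]
  · intro k hk hkK
    obtain ⟨y, hyY, hy, hreach⟩ := Coherent.chainSet_reach h (hk.resolve_left hkK)
    refine ⟨y, (h.subS hyY).1, Or.inr hy, ?_⟩
    exact Relation.ReflTransGen.mono (fun a b hab => ⟨hab.1.1.1, Or.inr hab.2⟩) k y hreach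

end

section

variable {D : Set (V × V)} {T K Q C : Set V} {r t : V}

/-- `b` can be reached from `a` along edges of `D` whose heads lie in `Q`. -/
def Reaches (D : Set (V × V)) (Q : Set V) : V → V → Prop :=
  Relation.ReflTransGen fun a b => (a, b) ∈ D ∧ b ∈ Q

theorem Reaches.mono {D' : Set (V × V)} {a b : V} (h : Reaches D Q a b) (hD : D ⊆ D')
    (hQ : Q ⊆ C) : Reaches D' C a b :=
  Relation.ReflTransGen.mono (fun _ _ h => ⟨hD h.1, hQ h.2⟩) a b h

theorem Reaches.exists_finite {a b : V} (h : Reaches D C a b) :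
    ∃ Q ⊆ C, Q.Finite ∧ Reaches D Q a b := by
  induction h with
  | refl => exact ⟨∅, Set.empty_subset _, Set.finite_empty, .refl⟩
  | @tail b c _ hbc ih =>
    obtain ⟨Q, hQ, hf, hr⟩ := ih
    exact ⟨insert c Q, Set.insert_subset hbc.2 hQ, hf.insert c,
      (hr.mono subset_rfl (Set.subset_insert c Q)).tail ⟨hbc.1, Or.inl rfl⟩⟩

/-- The in-neighbours of the vertices in `K`. -/
def inNbrs (D : Set (V × V)) (K : Set V) : Set V := {x | ∃ k ∈ K, (x, k) ∈ D}

theorem isHind_iUnion {K : ℕ → Set V} (hrT : r ∉ T) (ht : t ∈ T) (hrK : ∀ n, r ∉ K n)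
    (hmono : Monotone K)
    (hS : ∀ n, inNbrs D (insert t (K n)) ⊆ maxWave (del (del D {t}) (K (n + 1))) (T \ {t}) r) :
    IsHind D T r (⋃ n, maxWave (del (del D {t}) (K n)) (T \ {t}) r) {t} := by
  set Z : ℕ → Set V := fun n => maxWave (del (del D {t}) (K n)) (T \ {t}) r with hZ
  have hrt : r ≠ t := fun hh => hrT (hh ▸ ht)
  have htZ : ∀ n, t ∈ Z n := by
    intro n
    have := deleted_subset_maxWave (D := D) (T := T \ {t}) (r := r) (K := {t} ∪ K n)
      (by rintro (hh | hh); exacts [hrt hh, hrK n hh])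
    rw [← del_del] at this
    exact this (Or.inl rfl)
  have hKZ : ∀ n, K n ⊆ Z n := fun n => deleted_subset_maxWave (hrK n)
  have hin : ∀ m, ∀ x ∈ insert t (K m), ∀ q, (q, x) ∈ D → q ∈ ⋃ n, Z n :=
    fun m x hx q hq => Set.mem_iUnion.2 ⟨m + 1, hS m ⟨x, hx, hq⟩⟩
  choose hr s hs using fun n => isWave_maxWave (del (del D {t}) (K n)) (T \ {t}) r
  have hlink : ∀ n, Linkage D (Z n) T (entrance D (⋃ n, Z n) ∪ {t}) (s n) := by
    intro n
    have h := ((hs n).graph fun _ _ _ h => h.1.1).mono_target (T' := T) fun x hx => hx.1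
    refine ⟨h.maps, h.edge, ?_, h.inj, h.fin⟩
    rintro z hz hzT (⟨-, q, hq, hqx⟩ | hh)
    · refine (hs n).avoid z hz (fun hh => hzT hh.1) ⟨h.maps z hz hzT, q,
        fun hh => hq (Set.mem_iUnion.2 ⟨n, hh⟩), ⟨hqx, ?_, ?_⟩, ?_, ?_⟩
      · rintro rfl; exact hq (Set.mem_iUnion.2 ⟨n, htZ n⟩)
      · exact fun hh => hq (hin n _ (Or.inl hh) q hqx)
      · exact fun hh => hq (Set.mem_iUnion.2 ⟨n, hKZ n hh⟩)
      · exact fun hh => hq (hin n _ (Or.inr hh) q hqx)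
    · rcases (hs n).edge z hz (fun hh => hzT hh.1) with h' | h'
      · exact hzT (h' ▸ hh ▸ ht)
      · exact h'.1.2.2 hh
  obtain ⟨τ, hτ⟩ := Linkage.iUnion hlink (by
    intro i j hij z hz hzT z' hz' hzi hzT' he
    have hm := (hlink i).maps z hz hzT
    rcases (hs j).edge z' hz' (fun hh => hzT' hh.1) with h' | h'
    · exact hzi (h' ▸ he ▸ hm)
    · rw [← he] at h'
      exact (hs i).avoid z hz (fun hh => hzT hh.1) ⟨hm, z', hzi, h'.1,
        fun hh => h'.2.1 (hmono hij.le hh), fun hh => h'.2.2 (hmono hij.le hh)⟩)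
  refine ⟨?_, ?_, ?_, ?_, τ, hτ⟩
  · simpa using hr
  · rintro _ rfl; exact Set.mem_iUnion.2 ⟨0, htZ 0⟩
  · rintro _ rfl; exact ht
  · rintro _ rfl ⟨-, q, hq, hqt⟩
    exact hq (hin 0 _ (Or.inl rfl) q hqt)

/-- In an unhindered web each target can be linked to the root by a path whose deletion leaves the
remaining web unhindered. -/
theorem Unhindered.exists_safe_link (h : Unhindered D T r) (hrT : r ∉ T) (ht : t ∈ T) :
    ∃ Q : Set V, Q.Finite ∧ r ∉ Q ∧ t ∈ Q ∧ (∀ q ∈ Q, q ∈ T → q = t) ∧ Reaches D Q r t ∧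
      Unhindered (del D Q) (T \ {t}) r := by
  have hrt : r ≠ t := fun hh => hrT (hh ▸ ht)
  have hrT' : r ∉ T \ {t} := fun hh => hrT hh.1
  let α := {K : Set V // Nice (del D {t}) (T \ {t}) r K ∧ ∀ k ∈ K, Reaches D (insert t K) k t}
  have hstep : ∀ a : α, ∃ b : α, a.1 ⊆ b.1 ∧ (r ∉ inNbrs D (insert t a.1) →
      inNbrs D (insert t a.1) ⊆ maxWave (del (del D {t}) b.1) (T \ {t}) r) := by
    rintro ⟨K, hN, hR⟩
    by_cases hrS : r ∈ inNbrs D (insert t K)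
    · exact ⟨⟨K, hN, hR⟩, subset_rfl, fun hh => absurd hrS hh⟩
    · obtain ⟨K', hKK, hN', hS, hR'⟩ := hN.exists_step hrT' hrS
      refine ⟨⟨K', hN', fun k hk => ?_⟩, hKK, fun _ => hS⟩
      by_cases hkK : k ∈ K
      · exact (hR k hkK).mono subset_rfl (Set.insert_subset_insert hKK)
      · obtain ⟨x, ⟨y, hy, hxy⟩, -, hreach⟩ := hR' k hk hkK
        have h1 : Reaches D (insert t K') k x :=
          Reaches.mono hreach (del_subset _ _) (Set.subset_insert _ _)
        have h2 : Reaches D (insert t K') k y :=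
          h1.tail ⟨hxy, Set.insert_subset_insert hKK hy⟩
        rcases hy with rfl | hy
        · exact h2
        · exact h2.trans ((hR y hy).mono subset_rfl (Set.insert_subset_insert hKK))
  choose f hf hf' using hstep
  let s : ℕ → α := fun n => f^[n] ⟨∅, (h.del_singleton_target ht hrt).nice_empty, by simp⟩
  have hs : ∀ n, s (n + 1) = f (s n) := fun n => Function.iterate_succ_apply' f n _
  by_cases hex : ∃ n, r ∈ inNbrs D (insert t (s n).1)
  · obtain ⟨n, y, hy, hry⟩ := hex
    obtain ⟨hN, hR⟩ := (s n).2
    have hreach : Reaches D (insert t (s n).1) r t := by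
      have h1 : Reaches D (insert t (s n).1) r y := .single ⟨hry, hy⟩
      rcases hy with rfl | hy
      exacts [h1, h1.trans (hR y hy)]
    obtain ⟨Q, hQ, hQf, hQr⟩ := hreach.exists_finite
    have hQ' : insert t Q ⊆ insert t (s n).1 := Set.insert_subset (Or.inl rfl) hQ
    refine ⟨insert t Q, hQf.insert t, fun hh => ?_, Or.inl rfl, fun q hq hqT => ?_,
      hQr.mono subset_rfl (Set.subset_insert _ _), ?_⟩
    · exact (hQ' hh).elim hrt hN.root
    · by_contra hqt
      exact hN.disj q ((hQ' hq).resolve_left hqt) ⟨hqT, hqt⟩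
    · have := hN.unh (insert t Q \ {t}) (fun x hx => (hQ' hx.1).resolve_left hx.2)
        ((hQf.insert t).subset Set.sdiff_subset)
      rw [del_del] at this
      convert this using 2
      ext x
      by_cases hx : x = t <;> simp [hx]
  · push Not at hex
    refine absurd (isHind_iUnion (K := fun n => (s n).1) hrT ht (fun n => (s n).2.1.root)
      (monotone_nat_of_le_succ fun n => ?_) fun n => ?_) (h _ t)
    · rw [hs]; exact hf _
    · rw [hs]; exact hf' _ (hex n)

end

section

theorem mem_zip_tail {l : List V} {a b : V} :
    (a, b) ∈ l.zip l.tail ↔ ∃ l₁ l₂, l = l₁ ++ a :: b :: l₂ := by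
  induction l with
  | nil => simp
  | cons x l ih =>
    cases l with
    | nil =>
      simp only [List.tail_cons, List.zip_nil_right, List.not_mem_nil, false_iff, not_exists]
      intro l₁ l₂ h
      have := congrArg List.length h
      simp at this
      omega
    | cons y l =>
      simp only [List.tail_cons, List.zip_cons_cons, List.mem_cons, Prod.mk.injEq] at ih ⊢
      rw [ih]
      constructor
      · rintro (⟨rfl, rfl⟩ | ⟨l₁, l₂, h⟩)
        · exact ⟨[], l, rfl⟩
        · exact ⟨x :: l₁, l₂, by rw [h]; rfl⟩
      · rintro ⟨l₁, l₂, h⟩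
        cases l₁ with
        | nil =>
          simp only [List.nil_append, List.cons.injEq] at h
          exact Or.inl ⟨h.1.symm, h.2.1.symm⟩
        | cons z l₁ =>
          simp only [List.cons_append, List.cons.injEq] at h
          exact Or.inr ⟨l₁, l₂, h.2⟩

namespace DiPath

variable (P : DiPath V)

theorem mem_edges {a b : V} : (a, b) ∈ P.edges ↔ ∃ l₁ l₂, P.verts = l₁ ++ a :: b :: l₂ :=
  mem_zip_tail

theorem first_mem : P.first ∈ P.vertexSet := List.head_mem P.ne

theorem last_mem : P.last ∈ P.vertexSet := List.getLast_mem P.ne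

theorem vertexSet_finite : P.vertexSet.Finite := List.finite_toSet P.verts

theorem mem_of_edge {a b : V} (h : (a, b) ∈ P.edges) : a ∈ P.vertexSet ∧ b ∈ P.vertexSet := by
  obtain ⟨l₁, l₂, h⟩ := P.mem_edges.1 h
  simp [vertexSet, h]

theorem eq_first_or_head {x : V} (hx : x ∈ P.vertexSet) : x = P.first ∨ ∃ y, (y, x) ∈ P.edges := by
  obtain ⟨l₁, l₂, h⟩ := List.append_of_mem (show x ∈ P.verts from hx)
  rcases List.eq_nil_or_concat l₁ with rfl | ⟨l, y, rfl⟩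
  · left
    simp [first, h]
  · exact Or.inr ⟨y, P.mem_edges.2 ⟨l, l₂, by simp [h]⟩⟩

theorem eq_last_or_tail {x : V} (hx : x ∈ P.vertexSet) : x = P.last ∨ ∃ y, (x, y) ∈ P.edges := by
  obtain ⟨l₁, l₂, h⟩ := List.append_of_mem (show x ∈ P.verts from hx)
  cases l₂ with
  | nil =>
    left
    simp [last, h]
  | cons y l => exact Or.inr ⟨y, P.mem_edges.2 ⟨l₁, l, h⟩⟩

theorem edge_inj {a a' b : V} (h : (a, b) ∈ P.edges) (h' : (a', b) ∈ P.edges) : a = a' := by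
  obtain ⟨l₁, l₂, h⟩ := P.mem_edges.1 h
  obtain ⟨l₁', l₂', h'⟩ := P.mem_edges.1 h'
  have hn := P.nodup
  have key : ∀ l l' m m' : List V, (l ++ b :: m).Nodup → l ++ b :: m = l' ++ b :: m' → l = l' := by
    intro l l' m m' hnd he
    induction l generalizing l' with
    | nil =>
      cases l' with
      | nil => rfl
      | cons c l' =>
        simp only [List.nil_append, List.cons_append, List.cons.injEq] at he
        simp [he.2] at hnd
    | cons c l ih =>
      cases l' with
      | nil =>
        simp only [List.nil_append, List.cons_append, List.cons.injEq] at he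
        simp [he.1] at hnd
      | cons c' l' =>
        simp only [List.cons_append, List.cons.injEq] at he
        rw [he.1, ih l' (List.nodup_cons.1 hnd).2 he.2]
  have := key (l₁ ++ [a]) (l₁' ++ [a']) l₂ l₂' (by rw [h] at hn; simpa using hn) (by
    simpa using h.symm.trans h')
  simpa using congrArg List.getLast? this

theorem edge_first {a : V} : (a, P.first) ∉ P.edges := by
  intro hh
  obtain ⟨l₁, l₂, h⟩ := P.mem_edges.1 hh
  have hn := P.nodup
  have hf : P.verts.head P.ne = P.first := rfl
  cases l₁ with
  | nil =>
    simp only [h, List.nil_append, List.head_cons] at hf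
    rw [h, ← hf] at hn
    simp at hn
  | cons c l₁ =>
    simp only [h, List.cons_append, List.head_cons] at hf
    rw [h, ← hf] at hn
    simp at hn

theorem exists_lastEdge (h : P.first ≠ P.last) : ∃ y, P.lastEdge = {(y, P.last)} := by
  obtain ⟨y, hy⟩ := (P.eq_first_or_head P.last_mem).resolve_left h.symm
  refine ⟨y, Set.eq_singleton_iff_unique_mem.2 ⟨⟨hy, rfl⟩, ?_⟩⟩
  rintro ⟨a, b⟩ ⟨hab, hb : b = P.last⟩
  subst hb
  rw [P.edge_inj hab hy]

/-- The last edge by which a path enters a set `B` that it does not leave any more. -/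
theorem exists_entering {B : Set V} (hf : P.first ∉ B) (hl : P.last ∈ B) :
    ∃ p x, p ∉ B ∧ (p, x) ∈ P.edges ∧ x ∈ B ∧
      Relation.ReflTransGen (fun a b => (a, b) ∈ P.edges ∧ b ∈ B) x P.last ∧
      (p = P.first → ∀ y ∈ P.vertexSet, y ≠ P.first → y ∈ B) := by
  have split : ∀ l : List V, (∀ y ∈ l, y ∈ B) ∨
      ∃ l₁ p l₂, l = l₁ ++ p :: l₂ ∧ p ∉ B ∧ ∀ y ∈ l₂, y ∈ B := by
    intro l
    induction l with
    | nil => simp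
    | cons a l ih =>
      rcases ih with ih | ⟨l₁, p, l₂, rfl, h⟩
      · by_cases ha : a ∈ B
        · exact Or.inl (by simpa [ha] using ih)
        · exact Or.inr ⟨[], a, l, rfl, ha, ih⟩
      · exact Or.inr ⟨a :: l₁, p, l₂, rfl, h⟩
  obtain ⟨l₁, p, l₂, h, hp, hl₂⟩ := (split P.verts).resolve_left fun hh => hf (hh _ P.first_mem)
  cases l₂ with
  | nil =>
    have : p = P.last := by simp [last, h]
    exact absurd (this ▸ hl) hp
  | cons x l₂ =>
    refine ⟨p, x, hp, P.mem_edges.2 ⟨l₁, l₂, h⟩, hl₂ x (by simp), ?_, ?_⟩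
    · have walk : ∀ (m : List V) (x : V) (l : List V), P.verts = l ++ x :: m → (∀ y ∈ m, y ∈ B) →
          Relation.ReflTransGen (fun a b => (a, b) ∈ P.edges ∧ b ∈ B) x P.last := by
        intro m
        induction m with
        | nil =>
          intro x l hl _
          have : x = P.last := by simp [last, hl]
          rw [this]
        | cons y m ih =>
          intro x l hl hm
          exact .head ⟨P.mem_edges.2 ⟨l, m, hl⟩, hm y (by simp)⟩
            (ih y (l ++ [x]) (by simp [hl]) fun z hz => hm z (by simp [hz]))
      exact walk l₂ x (l₁ ++ [p]) (by simp [h]) fun y hy => hl₂ y (by simp [hy])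
    · intro hpf y hy hyf
      have hfirst : P.verts.head P.ne = P.first := rfl
      have hn := P.nodup
      cases l₁ with
      | nil =>
        have hy' : y ∈ P.verts := hy
        rw [h] at hy'
        rcases List.mem_cons.1 hy' with rfl | hy'
        · exact absurd hpf hyf
        · exact hl₂ y hy'
      | cons c l₁ =>
        simp only [h, List.cons_append, List.head_cons] at hfirst
        rw [h, hpf, ← hfirst] at hn
        simp at hn

end DiPath

theorem exists_isPath {D : Set (V × V)} {a b : V}
    (h : Relation.ReflTransGen (fun x y => (x, y) ∈ D) a b) : ∃ P, IsPath D a b P := by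
  induction h with
  | refl =>
    refine ⟨⟨[a], by simp, by simp⟩, ?_, rfl, rfl⟩
    rintro e he
    simp [DiPath.edges] at he
  | @tail b c _ hbc ih =>
    obtain ⟨P, hP, hf, hl⟩ := ih
    by_cases hc : c ∈ P.verts
    · obtain ⟨l₁, l₂, h⟩ := List.append_of_mem hc
      refine ⟨⟨l₁ ++ [c], by simp, ?_⟩, ?_, ?_, by simp [DiPath.last]⟩
      · have := P.nodup
        rw [h, List.append_cons] at this
        exact this.of_append_left
      · rintro ⟨x, y⟩ hxy
        obtain ⟨m₁, m₂, hm⟩ := (DiPath.mem_edges _).1 hxy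
        refine hP (P.mem_edges.2 ⟨m₁, m₂ ++ l₂, ?_⟩)
        simp only at hm
        rw [h, List.append_cons, hm]
        simp
      · rw [← hf]
        cases l₁ <;> simp [DiPath.first, h]
    · refine ⟨⟨P.verts ++ [c], by simp, ?_⟩, ?_, ?_, by simp [DiPath.last]⟩
      · exact List.nodup_append.2 ⟨P.nodup, by simp, fun x hx y hy => by
          rintro rfl; simp at hy; exact hc (hy ▸ hx)⟩
      · rintro ⟨x, y⟩ hxy
        obtain ⟨m₁, m₂, hm⟩ := (DiPath.mem_edges _).1 hxy
        simp only at hm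
        rcases List.eq_nil_or_concat m₂ with rfl | ⟨m, z, rfl⟩
        · have hm' : P.verts ++ [c] = (m₁ ++ [x]) ++ [y] := by simpa using hm
          obtain ⟨h1, h2⟩ := List.append_inj' hm' rfl
          have hx : P.last = x := by simp [DiPath.last, h1]
          have hy : c = y := by simpa using h2
          rw [← hx, ← hy, hl]
          exact hbc
        · have hm' : P.verts ++ [c] = (m₁ ++ x :: y :: m) ++ [z] := by simpa using hm
          exact hP (P.mem_edges.2 ⟨m₁, m, (List.append_inj' hm' rfl).1⟩)
      · rw [← hf]
        simp [DiPath.first, List.head_append_of_ne_nil P.ne]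

end

section

variable {D : Set (V × V)} {T : Set V} {r : V}

/-- The sets linked so far in a greedy construction of disjoint paths from the root. -/
structure Linked (D : Set (V × V)) (T : Set V) (r : V) (A : Set V) (q : V → Set V) : Prop where
  sub : A ⊆ T
  finA : A.Finite
  fin : ∀ t ∈ A, (q t).Finite
  root : ∀ t ∈ A, r ∉ q t
  mem : ∀ t ∈ A, t ∈ q t
  inter : ∀ t ∈ A, ∀ x ∈ q t, x ∈ T → x = t
  disj : ∀ t ∈ A, ∀ t' ∈ A, t ≠ t' → ∀ x ∈ q t, x ∉ q t'
  reach : ∀ t ∈ A, Reaches D (q t) r t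
  unh : Unhindered (del D (⋃ t ∈ A, q t)) (T \ A) r

theorem Linked.insert {A : Set V} {q : V → Set V} (h : Linked D T r A q) (hr : r ∉ T) {t : V}
    (ht : t ∈ T) (htA : t ∉ A) :
    ∃ q', (∀ a ∈ A, q' a = q a) ∧ Linked D T r (insert t A) q' := by
  classical
  obtain ⟨Q, hQf, hrQ, htQ, hQT, hreach, hU⟩ :=
    h.unh.exists_safe_link (fun hh => hr hh.1) ⟨ht, htA⟩
  set W := ⋃ t ∈ A, q t with hW
  have htW : t ∉ W := by
    intro hh
    obtain ⟨a, ha, hta⟩ := Set.mem_iUnion₂.1 hh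
    exact htA (h.inter a ha t hta ht ▸ ha)
  have hq : ∀ a ∈ A, Function.update q t (Q \ W) a = q a := fun a ha =>
    Function.update_of_ne (fun hh : a = t => htA (hh ▸ ha)) _ _
  have hqW : ∀ a ∈ A, ∀ x ∈ q a, x ∈ W := fun a ha x hx => Set.mem_biUnion ha hx
  refine ⟨Function.update q t (Q \ W), hq, ?_, h.finA.insert t, ?_, ?_, ?_, ?_, ?_, ?_, ?_⟩
  · exact Set.insert_subset ht h.sub
  · rintro a (rfl | ha)
    · rw [Function.update_self]; exact hQf.subset Set.sdiff_subset
    · rw [hq a ha]; exact h.fin a ha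
  · rintro a (rfl | ha)
    · rw [Function.update_self]; exact fun hh => hrQ hh.1
    · rw [hq a ha]; exact h.root a ha
  · rintro a (rfl | ha)
    · rw [Function.update_self]; exact ⟨htQ, htW⟩
    · rw [hq a ha]; exact h.mem a ha
  · rintro a (rfl | ha)
    · rw [Function.update_self]
      rintro x ⟨hx, hxW⟩ hxT
      by_cases hxA : x ∈ A
      · exact absurd (hqW x hxA x (h.mem x hxA)) hxW
      · exact hQT x hx ⟨hxT, hxA⟩
    · rw [hq a ha]; exact h.inter a ha
  · rintro a (rfl | ha) b (rfl | hb) hab x hx hx'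
    · exact hab rfl
    · rw [Function.update_self] at hx
      rw [hq b hb] at hx'
      exact hx.2 (hqW b hb x hx')
    · rw [Function.update_self] at hx'
      rw [hq a ha] at hx
      exact hx'.2 (hqW a ha x hx)
    · rw [hq a ha] at hx
      rw [hq b hb] at hx'
      exact h.disj a ha b hb hab x hx hx'
  · rintro a (rfl | ha)
    · rw [Function.update_self]
      exact Relation.ReflTransGen.mono (fun x y h => ⟨h.1.1, h.2, h.1.2.2⟩) _ _ hreach
    · rw [hq a ha]; exact h.reach a ha
  · rw [del_del] at hU
    have e1 : (⋃ a ∈ Insert.insert t A, Function.update q t (Q \ W) a) = W ∪ Q := by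
      rw [Set.biUnion_insert, Function.update_self, Set.iUnion₂_congr hq, ← hW, Set.union_comm,
        Set.union_sdiff_self]
    have e2 : T \ Insert.insert t A = (T \ A) \ {t} := by
      ext x; simp only [Set.mem_sdiff, Set.mem_insert_iff, Set.mem_singleton_iff]; tauto
    rw [e1, e2]
    exact hU

theorem Linked.extend {A : Set V} {q : V → Set V} (h : Linked D T r A q) (hr : r ∉ T) {N : Set V}
    (hN : N.Finite) (hNT : N ⊆ T) :
    ∃ A' q', A ⊆ A' ∧ N ⊆ A' ∧ (∀ a ∈ A, q' a = q a) ∧ Linked D T r A' q' := by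
  induction N, hN using Set.Finite.induction_on with
  | empty => exact ⟨A, q, subset_rfl, Set.empty_subset _, fun _ _ => rfl, h⟩
  | @insert t N _ _ ih =>
    obtain ⟨A', q', hA, hN, hq, h'⟩ := ih fun x hx => hNT (Or.inr hx)
    by_cases htA : t ∈ A'
    · exact ⟨A', q', hA, Set.insert_subset htA hN, hq, h'⟩
    · obtain ⟨q'', hq', h''⟩ := h'.insert hr (hNT (Or.inl rfl)) htA
      exact ⟨Set.insert t A', q'', hA.trans (Set.subset_insert _ _), Set.insert_subset_insert hN,
        fun a ha => (hq' a (hA ha)).trans (hq a ha), h''⟩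

/-- Disjoint paths from the root to a set `A` of targets such that every target in `N x` is linked
as soon as some path uses `x`. -/
theorem Unhindered.exists_closed_linking (h : Unhindered D T r) (hr : r ∉ T) {u : V} (hu : u ∈ T)
    (N : V → Set V) (hN : ∀ x, (N x).Finite) (hNT : ∀ x, N x ⊆ T) :
    ∃ (A : Set V) (q : V → Set V), A ⊆ T ∧ u ∈ A ∧ (∀ t ∈ A, r ∉ q t) ∧
      (∀ t ∈ A, ∀ x ∈ q t, x ∈ T → x = t) ∧
      (∀ t ∈ A, ∀ t' ∈ A, t ≠ t' → ∀ x ∈ q t, x ∉ q t') ∧ (∀ t ∈ A, Reaches D (q t) r t) ∧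
      (∀ t ∈ A, ∀ x ∈ q t, ∃ p, (p, x) ∈ D) ∧ ∀ t ∈ A, ∀ x ∈ q t, N x ⊆ A := by
  let α := {s : Set V × (V → Set V) // Linked D T r s.1 s.2}
  have h0 : Linked D T r ∅ fun _ => ∅ := by
    refine ⟨?_, ?_, ?_, ?_, ?_, ?_, ?_, ?_, ?_⟩ <;> simp [del_empty, h]
  have hstep : ∀ s : α, ∃ s' : α, s.1.1 ⊆ s'.1.1 ∧ u ∈ s'.1.1 ∧
      (∀ a ∈ s.1.1, s'.1.2 a = s.1.2 a) ∧ ∀ t ∈ s.1.1, ∀ x ∈ s.1.2 t, N x ⊆ s'.1.1 := by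
    rintro ⟨⟨A, q⟩, hs⟩
    obtain ⟨A', q', h1, h2, h3, h4⟩ := hs.extend hr (N := insert u (⋃ t ∈ A, ⋃ x ∈ q t, N x))
      ((hs.finA.biUnion fun t ht => (hs.fin t ht).biUnion fun x _ => hN x).insert u)
      (Set.insert_subset hu (Set.iUnion₂_subset fun t _ => Set.iUnion₂_subset fun x _ => hNT x))
    exact ⟨⟨(A', q'), h4⟩, h1, h2 (Or.inl rfl), h3, fun t ht x hx y hy =>
      h2 (Or.inr (Set.mem_biUnion ht (Set.mem_biUnion hx hy)))⟩
  choose f hf1 hf2 hf3 hf4 using hstep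
  let s : ℕ → α := fun n => f^[n] ⟨(∅, fun _ => ∅), h0⟩
  have hs : ∀ n, s (n + 1) = f (s n) := fun n => Function.iterate_succ_apply' f n _
  have hmono : Monotone fun n => (s n).1.1 := monotone_nat_of_le_succ fun n => by
    rw [hs]; exact hf1 _
  have hval : ∀ n m, n ≤ m → ∀ a ∈ (s n).1.1, (s m).1.2 a = (s n).1.2 a := by
    intro n m hnm
    induction m, hnm using Nat.le_induction with
    | base => exact fun _ _ => rfl
    | succ m hnm ih =>
      intro a ha
      rw [hs, hf3 _ a (hmono hnm ha), ih a ha]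
  have hex : ∀ t ∈ ⋃ n, (s n).1.1, ∃ n, t ∈ (s n).1.1 := fun t ht => Set.mem_iUnion.1 ht
  choose! n hn using hex
  let q : V → Set V := fun t => {x ∈ (s (n t)).1.2 t | ∃ p, (p, x) ∈ D}
  have hrt : ∀ t ∈ ⋃ n, (s n).1.1, Reaches D (q t) r t := by
    intro t ht
    exact Relation.ReflTransGen.mono (fun a b h => ⟨h.1, h.2, a, h.1⟩) _ _
      ((s (n t)).2.reach t (hn t ht))
  refine ⟨⋃ n, (s n).1.1, q, ?_, ?_, ?_, ?_, ?_, hrt, fun t _ x hx => hx.2, ?_⟩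
  · exact Set.iUnion_subset fun n => (s n).2.sub
  · refine Set.mem_iUnion.2 ⟨1, ?_⟩
    rw [hs 0]
    exact hf2 _
  · exact fun t ht hh => (s (n t)).2.root t (hn t ht) hh.1
  · exact fun t ht x hx hxT => (s (n t)).2.inter t (hn t ht) x hx.1 hxT
  · intro t ht t' ht' hne x hx hx'
    have h1 := hval (n t) (max (n t) (n t')) (le_max_left _ _) t (hn t ht)
    have h2 := hval (n t') (max (n t) (n t')) (le_max_right _ _) t' (hn t' ht')
    refine (s (max (n t) (n t'))).2.disj t (hmono (le_max_left _ _) (hn t ht)) t'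
      (hmono (le_max_right _ _) (hn t' ht')) hne x ?_ ?_
    · rw [h1]; exact hx.1
    · rw [h2]; exact hx'.1
  · intro t ht x hx y hy
    refine Set.mem_iUnion.2 ⟨n t + 1, ?_⟩
    rw [hs]
    exact hf4 _ t (hn t ht) x hx.1 hy

end

section

variable {H : Set (V × V)} {r v : V} {B : Set V}

/-- The vertex `v` together with its in-neighbours in `H` other than the root `r`. -/
def closedInNeighbors (H : Set (V × V)) (r v : V) : Set V :=
  insert v {x | (x, v) ∈ H \ {(r, v)}}

theorem root_notMem_closedInNeighbors (hv : v ≠ r) : r ∉ closedInNeighbors H r v := by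
  rintro (h | h)
  exacts [hv h.symm, h.2 rfl]

theorem IsBubble.isWave (h : IsBubble H r v B) :
    IsWave (H \ {(r, v)}) (closedInNeighbors H r v) r B := by
  classical
  obtain ⟨hr, F, hF, hd⟩ := h
  refine ⟨hr, ?_⟩
  have hsub : ∀ e ∈ entrance H B, ∀ x ∈ (F e).vertexSet, x ∈ B := by
    intro e he x hx
    obtain ⟨h1, h2, h3⟩ := hF e he
    rcases (F e).eq_first_or_head hx with rfl | ⟨y, hy⟩
    · rw [h2]; exact he.1
    · exact (h1 hy).2.2
  have huniq : ∀ e ∈ entrance H B, ∀ e' ∈ entrance H B, ∀ x ∈ (F e).vertexSet,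
      x ∈ (F e').vertexSet → x ≠ v → e = e' := by
    intro e he e' he' x hx hx' hxv
    by_contra hne
    have : x ∈ ({v} : Set V) := hd e he e' he' hne ▸ ⟨hx, hx'⟩
    exact hxv this
  have hnext : ∀ e ∈ entrance H B, ∀ x ∈ (F e).vertexSet, x ≠ v → ∃ y, (x, y) ∈ (F e).edges := by
    intro e he x hx hxv
    exact ((F e).eq_last_or_tail hx).resolve_left fun hh => hxv (hh.trans (hF e he).2.2)
  let σ : V → V := fun z =>
    if h : ∃ y, ∃ e ∈ entrance H B, (z, y) ∈ (F e).edges then h.choose else z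
  have hσ : ∀ z, (∃ y, ∃ e ∈ entrance H B, (z, y) ∈ (F e).edges) →
      ∃ e ∈ entrance H B, (z, σ z) ∈ (F e).edges := by
    intro z h
    have : σ z = h.choose := dif_pos h
    rw [this]
    exact h.choose_spec
  have hσ' : ∀ z, (¬ ∃ y, ∃ e ∈ entrance H B, (z, y) ∈ (F e).edges) → σ z = z :=
    fun z h => dif_neg h
  have hnev : ∀ z y, z ∉ closedInNeighbors H r v → ∀ e ∈ entrance H B, (z, y) ∈ (F e).edges →
      y ≠ v := by
    rintro z y hz e he hzy rfl
    have := (hF e he).1 hzy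
    exact hz (Or.inr ⟨this.1, fun hh => hr ((Prod.mk.inj hh).1 ▸ this.2.1)⟩)
  have hzv : ∀ z, z ∉ closedInNeighbors H r v → z ≠ v := fun z hz hh => hz (Or.inl hh)
  refine ⟨σ, ?_, ?_, ?_, ?_, ?_⟩
  · intro z hz hzT
    by_cases h : ∃ y, ∃ e ∈ entrance H B, (z, y) ∈ (F e).edges
    · obtain ⟨e, he, hze⟩ := hσ z h
      exact ((hF e he).1 hze).2.2
    · rw [hσ' z h]; exact hz
  · intro z hz hzT
    by_cases h : ∃ y, ∃ e ∈ entrance H B, (z, y) ∈ (F e).edges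
    · obtain ⟨e, he, hze⟩ := hσ z h
      exact Or.inr ⟨((hF e he).1 hze).1, fun hh => hr ((Prod.mk.inj hh).1 ▸ hz)⟩
    · exact Or.inl (hσ' z h)
  · rintro z hz hzT ⟨hx, q, hq, hqx⟩
    have hen : σ z ∈ entrance H B := ⟨hx, q, hq, hqx.1⟩
    have hmem : σ z ∈ (F (σ z)).vertexSet := by
      have := (F (σ z)).first_mem
      rwa [(hF _ hen).2.1] at this
    by_cases h : ∃ y, ∃ e ∈ entrance H B, (z, y) ∈ (F e).edges
    · obtain ⟨e, he, hze⟩ := hσ z h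
      have := huniq e he _ hen _ ((F e).mem_of_edge hze).2 hmem (hnev z _ hzT e he hze)
      have hf := (hF e he).2.1
      rw [← this, ← hf] at hze
      exact (F (F e).first).edge_first (by rw [hf] at hze ⊢; rw [hf]; exact hze)
    · have hzz := hσ' z h
      rw [hzz] at hen hmem
      obtain ⟨y, hy⟩ := hnext z hen z hmem (hzv z hzT)
      exact h ⟨y, z, hen, hy⟩
  · have aux : ∀ z, z ∉ closedInNeighbors H r v → ∀ z', z' ∉ closedInNeighbors H r v →
        σ z = σ z' → (∃ y, ∃ e ∈ entrance H B, (z, y) ∈ (F e).edges) → z = z' := by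
      intro z hzT z' hzT' he h
      obtain ⟨e, hee, hze⟩ := hσ z h
      have hne := hnev z _ hzT e hee hze
      have hm := ((F e).mem_of_edge hze).2
      by_cases h' : ∃ y, ∃ e ∈ entrance H B, (z', y) ∈ (F e).edges
      · obtain ⟨e', hee', hze'⟩ := hσ z' h'
        rw [he] at hne hm hze
        have := huniq e hee e' hee' _ hm ((F e').mem_of_edge hze').2 hne
        subst this
        exact (F e).edge_inj hze hze'
      · rw [he, hσ' z' h'] at hm
        obtain ⟨y, hy⟩ := hnext e hee z' hm (hzv z' hzT')
        exact absurd ⟨y, e, hee, hy⟩ h'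
    intro z hz hzT z' hz' hzT' he
    by_cases h : ∃ y, ∃ e ∈ entrance H B, (z, y) ∈ (F e).edges
    · exact aux z hzT z' hzT' he h
    by_cases h' : ∃ y, ∃ e ∈ entrance H B, (z', y) ∈ (F e).edges
    · exact (aux z' hzT' z hzT he.symm h').symm
    · rwa [hσ' z h, hσ' z' h'] at he
  · intro z hz
    by_cases h : ∃ y, ∃ e ∈ entrance H B, (z, y) ∈ (F e).edges
    · obtain ⟨e, he, hze⟩ := hσ z h
      refine ⟨(F e).vertexSet, (F e).vertexSet_finite, ((F e).mem_of_edge hze).1, hsub e he, ?_⟩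
      intro w hw hwT
      obtain ⟨y, hy⟩ := hnext e he w hw (hzv w hwT)
      obtain ⟨e', he', hwe⟩ := hσ w ⟨y, e, he, hy⟩
      have := huniq e he e' he' w hw ((F e').mem_of_edge hwe).1 (hzv w hwT)
      subst this
      exact ((F e).mem_of_edge hwe).2
    · refine ⟨{z}, Set.finite_singleton z, rfl, by simpa using hz, ?_⟩
      rintro w rfl _
      exact hσ' _ h

theorem IsWave.isBubble (h : IsWave (H \ {(r, v)}) (closedInNeighbors H r v) r B)
    (hvB : v ∈ B) : IsBubble H r v B := by
  obtain ⟨hr, σ, h⟩ := h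
  refine ⟨hr, ?_⟩
  have hne : ∀ e ∈ entrance H B, ∀ z ∈ B, z ∉ closedInNeighbors H r v → σ z ≠ e := by
    rintro e ⟨heB, q, hq, hqe⟩ z hz hzT he
    by_cases hev : e = v
    · rw [hev] at he
      rcases h.edge z hz hzT with h' | h'
      · exact hzT (Or.inl (h'.symm.trans he))
      · exact hzT (Or.inr (he ▸ h'))
    · exact h.avoid z hz hzT (he ▸ ⟨heB, q, hq, hqe, fun hh => hev (Prod.mk.inj hh).2⟩)
  have hpath : ∀ e ∈ entrance H B, ∃ n P, (∀ j < n, σ^[j] e ∉ closedInNeighbors H r v) ∧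
      IsPath (H ∩ B ×ˢ B) e v P ∧ ∀ x ∈ P.vertexSet, x = v ∨ ∃ i ≤ n, x = σ^[i] e := by
    intro e he
    obtain ⟨n, hn, hb⟩ := h.reach he.1 (hne e he)
    have hin : ∀ i ≤ n, σ^[i] e ∈ B := fun i hi => h.mem_iter he.1 i fun j hj => hb j (by omega)
    let E : Set (V × V) := {p ∈ H ∩ B ×ˢ B | p.2 = v ∨ ∃ i ≤ n, p.2 = σ^[i] e}
    have hiter : ∀ i ≤ n, Relation.ReflTransGen (fun x y => (x, y) ∈ E) e (σ^[i] e) := by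
      intro i
      induction i with
      | zero => exact fun _ => .refl
      | succ i ih =>
        intro hi
        have hi' := ih (by omega)
        rcases h.edge _ (hin i (by omega)) (hb i (by omega)) with h' | h'
        · rw [Function.iterate_succ_apply', h']; exact hi'
        · refine hi'.tail ⟨⟨?_, hin i (by omega), hin (i + 1) hi⟩, Or.inr ⟨i + 1, hi, rfl⟩⟩
          rw [Function.iterate_succ_apply']
          exact h'.1
    have hreach : Relation.ReflTransGen (fun x y => (x, y) ∈ E) e v := by
      rcases hn with hn | hn
      · exact hn ▸ hiter n le_rfl
      · exact (hiter n le_rfl).tail ⟨⟨hn.1, hin n le_rfl, hvB⟩, Or.inl rfl⟩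
    obtain ⟨P, hP1, hP2, hP3⟩ := exists_isPath hreach
    refine ⟨n, P, hb, ⟨fun p hp => (hP1 hp).1, hP2, hP3⟩, fun x hx => ?_⟩
    rcases P.eq_first_or_head hx with rfl | ⟨y, hy⟩
    · exact Or.inr ⟨0, Nat.zero_le n, hP2⟩
    · exact (hP1 hy).2
  have : Nonempty (DiPath V) := ⟨⟨[v], by simp, by simp⟩⟩
  choose! n F hb hF hx using hpath
  refine ⟨F, hF, fun e he e' he' hee => Set.Subset.antisymm ?_ ?_⟩
  · rintro x ⟨h1, h2⟩
    rcases hx e he x h1 with rfl | ⟨i, hi, rfl⟩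
    · rfl
    rcases hx e' he' _ h2 with h3 | ⟨j, hj, hij⟩
    · exact h3
    refine absurd (h.orbit_unique he.1 he'.1 (hne e he) (hne e' he') i j ?_ ?_ hij).2 hee
    · exact fun k hk => hb e he k (by omega)
    · exact fun k hk => hb e' he' k (by omega)
  · rintro _ rfl
    constructor
    · have := (F e).last_mem
      rwa [(hF e he).2.2] at this
    · have := (F e').last_mem
      rwa [(hF e' he').2.2] at this

theorem maxBubble_eq_maxWave (hv : v ≠ r) :
    maxBubble H r v = maxWave (H \ {(r, v)}) (closedInNeighbors H r v) r := by
  apply Set.Subset.antisymm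
  · exact Set.sUnion_subset fun B hB => (IsBubble.isWave hB).subset_maxWave
  · refine Set.subset_sUnion_of_mem ((isWave_maxWave _ _ _).isBubble ?_)
    exact target_subset_maxWave (root_notMem_closedInNeighbors hv) (Or.inl rfl)

end

section

variable {D₀ G : Set (V × V)} {r u w : V}

theorem IsPath.first_mem {P : DiPath V} (h : IsPath G r w P) : r ∈ P.vertexSet :=
  h.2.1 ▸ P.first_mem

theorem IsPath.last_mem {P : DiPath V} (h : IsPath G r w P) : w ∈ P.vertexSet :=
  h.2.2 ▸ P.last_mem

/-- Replacing the initial segment of a path. -/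
theorem IsPath.exists_reroute {P : DiPath V} (h : IsPath G r w P) (hD : D₀ ⊆ G) (hrw : r ≠ w)
    {B q : Set V} {t : V} (hwq : w ∉ q) (ht : Reaches D₀ q r t)
    (hP : Relation.ReflTransGen (fun a b => (a, b) ∈ P.edges ∧ b ∈ B) t w) :
    ∃ P', IsPath G r w P' ∧ P'.lastEdge = P.lastEdge ∧
      ∀ x ∈ P'.vertexSet, x = r ∨ x ∈ q ∨ x ∈ P.vertexSet ∧ x ∈ B := by
  obtain ⟨P', h1, h2, h3⟩ := exists_isPath
    (D := {e | e ∈ D₀ ∧ e.2 ∈ q} ∪ {e | e ∈ P.edges ∧ e.2 ∈ B}) (a := r) (b := w)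
    ((Relation.ReflTransGen.mono (fun _ _ h => Or.inl h) _ _ ht).trans
      (Relation.ReflTransGen.mono (fun _ _ h => Or.inr h) _ _ hP))
  refine ⟨P', ⟨fun e he => (h1 he).elim (fun h => hD h.1) fun h' => h.1 h'.1, h2, h3⟩, ?_, ?_⟩
  · obtain ⟨y, hy⟩ := P.exists_lastEdge (by rwa [h.2.1, h.2.2])
    obtain ⟨y', hy'⟩ := P'.exists_lastEdge (by rwa [h2, h3])
    rw [hy, hy', h.2.2, h3]
    have m : (y, P.last) ∈ P.edges := (hy.symm ▸ Set.mem_singleton _ : _ ∈ P.lastEdge).1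
    have m' : (y', P'.last) ∈ P'.edges := (hy'.symm ▸ Set.mem_singleton _ : _ ∈ P'.lastEdge).1
    rw [h.2.2] at m
    rw [h3] at m'
    rcases h1 m' with hh | hh
    · exact absurd hh.2 hwq
    · rw [P.edge_inj m hh.1]
  · intro x hx
    rcases P'.eq_first_or_head hx with hx | ⟨y, hy⟩
    · exact Or.inl (hx.trans h2)
    · rcases h1 hy with hh | hh
      · exact Or.inr (Or.inl hh.2)
      · exact Or.inr (Or.inr ⟨(P.mem_of_edge hh.1).2, hh.2⟩)

theorem Reaches.exists_isPath_through {q : Set V} (h : Reaches D₀ q r u) (hrw : r ≠ w)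
    (hwq : w ∉ q) (hD : D₀ ⊆ G) :
    ∃ P, IsPath (G ∪ {(u, w)}) r w P ∧ P.lastEdge = {(u, w)} ∧
      ∀ x ∈ P.vertexSet, x = r ∨ x = w ∨ x ∈ q := by
  obtain ⟨P, h1, h2, h3⟩ := exists_isPath
    (D := {e | e ∈ D₀ ∧ e.2 ∈ q} ∪ {(u, w)}) (a := r) (b := w)
    ((Relation.ReflTransGen.mono (fun _ _ h => Or.inl h) _ _ h).tail (Or.inr rfl))
  refine ⟨P, ⟨fun e he => (h1 he).imp (fun h => hD h.1) _root_.id, h2, h3⟩, ?_, ?_⟩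
  · obtain ⟨y, hy⟩ := P.exists_lastEdge (by rwa [h2, h3])
    have m : (y, P.last) ∈ P.edges := (hy.symm ▸ Set.mem_singleton _ : _ ∈ P.lastEdge).1
    rw [hy]
    rw [h3] at m ⊢
    rcases h1 m with hh | hh
    · exact absurd hh.2 hwq
    · rw [hh]
  · intro x hx
    rcases P.eq_first_or_head hx with hx | ⟨y, hy⟩
    · exact Or.inl (hx.trans h2)
    · rcases h1 hy with hh | hh
      · exact Or.inr (Or.inr hh.2)
      · exact Or.inr (Or.inl (Prod.mk.inj hh).2)

/-- Rerouting a family `K` of paths of an internally disjoint system along the sets `q t` makes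
room for a further path through `qu` with last edge `uw`. -/
theorem IntDisjSystem.union_lastEdge_mem_GSet {Ps K : Set (DiPath V)} (h : IntDisjSystem G r w Ps)
    (hD : D₀ ⊆ G) (hrw : r ≠ w) {A B qu : Set V} {q : V → Set V} {t : DiPath V → V}
    (hwq : ∀ a ∈ A, w ∉ q a) (hwu : w ∉ qu)
    (hqB : ∀ a ∈ A, ∀ x ∈ q a, x ∈ B → x = a) (huB : ∀ x ∈ qu, x ∉ B)
    (hq : ∀ a ∈ A, Reaches D₀ (q a) r a) (hu : Reaches D₀ qu r u)
    (hdisj : ∀ a ∈ A, ∀ b ∈ A, a ≠ b → ∀ x ∈ q a, x ∉ q b)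
    (hdisju : ∀ a ∈ A, ∀ x ∈ q a, x ∉ qu)
    (hKA : ∀ P ∈ K, t P ∈ A) (htP : ∀ P ∈ K, t P ∈ P.vertexSet) (hrA : r ∉ A) (hwA : w ∉ A)
    (htail : ∀ P ∈ K, Relation.ReflTransGen (fun a b => (a, b) ∈ P.edges ∧ b ∈ B) (t P) w)
    (hK : ∀ P ∈ Ps, P ∉ K → ∀ x ∈ P.vertexSet, x ≠ r → x ≠ w →
      x ∉ qu ∧ ∀ a ∈ A, x ∈ q a → x ∈ B) :
    lastEdges Ps ∪ {(u, w)} ∈ GSet (G ∪ {(u, w)}) r w := by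
  obtain ⟨hp, hd⟩ := h
  obtain ⟨P₀, hP₀, hl₀, hv₀⟩ := hu.exists_isPath_through (w := w) hrw hwu hD
  have hf : ∀ P ∈ Ps, ∃ P', IsPath G r w P' ∧ P'.lastEdge = P.lastEdge ∧
      (P ∈ K → ∀ x ∈ P'.vertexSet, x = r ∨ x ∈ q (t P) ∨ x ∈ P.vertexSet ∧ x ∈ B) ∧
      (P ∉ K → P' = P) := by
    intro P hPs
    by_cases hPK : P ∈ K
    · obtain ⟨P', h1, h2, h3⟩ := (hp P hPs).exists_reroute hD hrw (hwq _ (hKA P hPK))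
        (hq _ (hKA P hPK)) (htail P hPK)
      exact ⟨P', h1, h2, fun _ => h3, fun hh => absurd hPK hh⟩
    · exact ⟨P, hp P hPs, rfl, fun hh => absurd hh hPK, fun _ => rfl⟩
  have : Nonempty (DiPath V) := ⟨P₀⟩
  choose! f hf1 hf2 hf3 hf4 using hf
  have hmeet : ∀ P ∈ Ps, ∀ Q ∈ Ps, P ≠ Q → ∀ x ∈ P.vertexSet, x ∈ Q.vertexSet →
      x = r ∨ x = w := by
    intro P hP Q hQ hPQ x hx hx'
    have : x ∈ ({r, w} : Set V) := hd P hP Q hQ hPQ ▸ ⟨hx, hx'⟩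
    exact this
  have htmeet : ∀ P ∈ Ps, P ∈ K → ∀ Q ∈ Ps, P ≠ Q → t P ∉ Q.vertexSet := by
    intro P hP hPK Q hQ hPQ hh
    rcases hmeet P hP Q hQ hPQ _ (htP P hPK) hh with hh | hh
    exacts [hrA (hh ▸ hKA P hPK), hwA (hh ▸ hKA P hPK)]
  have hunch : ∀ P ∈ Ps, P ∈ K → ∀ Q ∈ Ps, Q ∉ K → P ≠ Q →
      ∀ x ∈ (f P).vertexSet, x ∈ Q.vertexSet → x = r ∨ x = w := by
    intro P hP hPK Q hQ hQK hPQ x hx hx'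
    rcases hf3 P hP hPK x hx with rfl | hx | ⟨hx, -⟩
    · exact Or.inl rfl
    · by_contra! hne
      have hxB := (hK Q hQ hQK x hx' hne.1 hne.2).2 _ (hKA P hPK) hx
      exact htmeet P hP hPK Q hQ hPQ (hqB _ (hKA P hPK) x hx hxB ▸ hx')
    · exact hmeet P hP Q hQ hPQ x hx hx'
  have hff : ∀ P ∈ Ps, ∀ Q ∈ Ps, P ≠ Q → ∀ x ∈ (f P).vertexSet, x ∈ (f Q).vertexSet →
      x = r ∨ x = w := by
    intro P hP Q hQ hPQ x hx hx'
    by_cases hPK : P ∈ K <;> by_cases hQK : Q ∈ K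
    · rcases hf3 P hP hPK x hx with rfl | hx | ⟨hx, hxB⟩
      · exact Or.inl rfl
      · rcases hf3 Q hQ hQK x hx' with rfl | hx' | ⟨hx', hxB'⟩
        · exact Or.inl rfl
        · refine absurd hx' (hdisj _ (hKA P hPK) _ (hKA Q hQK) (fun he => ?_) x hx)
          exact htmeet P hP hPK Q hQ hPQ (he ▸ htP Q hQK)
        · exact absurd (hqB _ (hKA P hPK) x hx hxB' ▸ hx') (htmeet P hP hPK Q hQ hPQ)
      · rcases hf3 Q hQ hQK x hx' with rfl | hx' | ⟨hx', -⟩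
        · exact Or.inl rfl
        · exact absurd (hqB _ (hKA Q hQK) x hx' hxB ▸ hx) (htmeet Q hQ hQK P hP hPQ.symm)
        · exact hmeet P hP Q hQ hPQ x hx hx'
    · rw [hf4 Q hQ hQK] at hx'
      exact hunch P hP hPK Q hQ hQK hPQ x hx hx'
    · rw [hf4 P hP hPK] at hx
      exact hunch Q hQ hQK P hP hPK hPQ.symm x hx' hx
    · rw [hf4 P hP hPK] at hx
      rw [hf4 Q hQ hQK] at hx'
      exact hmeet P hP Q hQ hPQ x hx hx'
  have hf0 : ∀ P ∈ Ps, ∀ x ∈ P₀.vertexSet, x ∈ (f P).vertexSet → x = r ∨ x = w := by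
    intro P hP x hx hx'
    by_contra! hne
    have hxu := ((hv₀ x hx).resolve_left hne.1).resolve_left hne.2
    by_cases hPK : P ∈ K
    · rcases (hf3 P hP hPK x hx').resolve_left hne.1 with hx' | ⟨-, hxB⟩
      exacts [hdisju _ (hKA P hPK) x hx' hxu, huB x hxu hxB]
    · rw [hf4 P hP hPK] at hx'
      exact (hK P hP hPK x hx' hne.1 hne.2).1 hxu
  have hinter : ∀ P Q : DiPath V, IsPath (G ∪ {(u, w)}) r w P → IsPath (G ∪ {(u, w)}) r w Q →
      (∀ x ∈ P.vertexSet, x ∈ Q.vertexSet → x = r ∨ x = w) →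
      P.vertexSet ∩ Q.vertexSet = {r, w} := by
    intro P Q hP hQ hx
    refine Set.Subset.antisymm (fun x hh => hx x hh.1 hh.2) ?_
    rintro _ (rfl | rfl)
    exacts [⟨hP.first_mem, hQ.first_mem⟩, ⟨hP.last_mem, hQ.last_mem⟩]
  have hf1' : ∀ P ∈ Ps, IsPath (G ∪ {(u, w)}) r w (f P) := fun P hP =>
    ⟨fun e he => Or.inl ((hf1 P hP).1 he), (hf1 P hP).2⟩
  refine ⟨insert P₀ (f '' Ps), ⟨?_, ?_⟩, ?_⟩
  · rintro _ (rfl | ⟨P, hP, rfl⟩)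
    exacts [hP₀, hf1' P hP]
  · rintro _ (rfl | ⟨P, hP, rfl⟩) _ (rfl | ⟨Q, hQ, rfl⟩) hPQ
    · exact absurd rfl hPQ
    · exact hinter _ _ hP₀ (hf1' Q hQ) (hf0 Q hQ)
    · exact hinter _ _ (hf1' P hP) hP₀ fun x hx hx' => hf0 P hP x hx' hx
    · exact hinter _ _ (hf1' P hP) (hf1' Q hQ)
        (hff P hP Q hQ fun he => hPQ (he ▸ rfl))
  · unfold lastEdges
    rw [Set.biUnion_insert, Set.biUnion_image, hl₀, Set.iUnion₂_congr hf2, Set.union_comm]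

end

/-- Single-edge extension lemma: under the stated conditions on `D ⊇ G ⊇ H`, `v` and
the edge `uw ∈ D∖G`, one has `I + uw ∈ 𝒢_{G+uw}(w)` for every `I ∈ 𝒢_G(w)`. -/
theorem extend_by_edge {V : Type u} [Infinite V] (r : V) (D G H : Set (V × V))
    (hroot : IsRooted D r) (hGD : G ⊆ D) (hHG : H ⊆ G)
    (v : V) (hv : v ≠ r) (u w : V)
    (huw : (u, w) ∈ D \ G) (hu : u ∉ maxBubble H r v)
    (hw : w ∈ interiorSet (H \ {(r, v)}) (maxBubble H r v))
    (hent : entrance (H \ {(r, v)}) (maxBubble H r v)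
      = entrance (G \ {(r, v)}) (maxBubble H r v)) :
    ∀ I ∈ GSet G r w, I ∪ {(u, w)} ∈ GSet (G ∪ {(u, w)}) r w := by
  classical
  rintro _ ⟨Ps, hPs, rfl⟩
  have hB := maxBubble_eq_maxWave (H := H) hv
  set B := maxBubble H r v
  set S := entrance (H \ {(r, v)}) B with hS
  have hrB : r ∉ B := hB ▸ root_notMem_maxWave
  have hrw : r ≠ w := fun he => hrB (he ▸ hw.1)
  set D₀ := outside (H \ {(r, v)}) B with hD₀
  have hDG : D₀ ⊆ G := fun e he => hHG he.1.1
  have hDS : ∀ p x, (p, x) ∈ D₀ → x ∈ B → x ∈ S := fun p x h hx => ⟨hx, p, h.2, h.1⟩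
  have hSB : S ⊆ B := fun x hx => hx.1
  by_cases hur : u = r
  · subst hur
    exact hPs.union_lastEdge_mem_GSet (D₀ := D₀) (K := ∅) (A := ∅) (B := B) (qu := ∅)
      (q := fun _ => ∅) (t := fun _ => u) hDG hrw (by simp) (by simp) (by simp) (by simp)
      (by simp) .refl (by simp) (by simp) (by simp) (by simp) (by simp) (by simp) (by simp)
      (by simp)
  have hU : Unhindered D₀ (insert u S) r := by
    have hU := unhindered_outside (H \ {(r, v)}) (closedInNeighbors H r v) r
    have hsub := fun W => IsWave.subset_maxWave_of_outside (D := H \ {(r, v)})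
      (T := closedInNeighbors H r v) (r := r) (W := W)
    rw [← hB] at hU hsub
    exact hU.insert_target fun W hW huW => hu (hsub W hW huW)
  have hrT : r ∉ insert u S := by
    rintro (he | he)
    exacts [hur he.symm, hrB he.1]
  have hpath : ∀ P ∈ Ps, (∀ x ∈ P.vertexSet, x ≠ r → x ∈ B) ∨ ∃ t ∈ S, t ∈ P.vertexSet ∧
      Relation.ReflTransGen (fun a b => (a, b) ∈ P.edges ∧ b ∈ B) t w := by
    intro P hP
    obtain ⟨h1, h2, h3⟩ := hPs.1 P hP
    obtain ⟨p, x, hp, hpx, hx, ht, hall⟩ := P.exists_entering (B := B) (by rwa [h2])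
      (by rw [h3]; exact hw.1)
    by_cases he : (p, x) = (r, v)
    · left
      have := hall ((Prod.mk.inj he).1.trans h2.symm)
      rwa [h2] at this
    · refine Or.inr ⟨x, ?_, (P.mem_of_edge hpx).2, h3 ▸ ht⟩
      rw [hent]
      exact ⟨hx, p, hp, h1 hpx, he⟩
  have : Nonempty V := ⟨r⟩
  let L : Set (DiPath V) := {P ∈ Ps | ¬ ∀ x ∈ P.vertexSet, x ≠ r → x ∈ B}
  have hL : ∀ P ∈ L, ∃ t ∈ S, t ∈ P.vertexSet ∧
      Relation.ReflTransGen (fun a b => (a, b) ∈ P.edges ∧ b ∈ B) t w :=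
    fun P hP => (hpath P hP.1).resolve_left hP.2
  choose! t htS htP ht using hL
  obtain ⟨A, q, hAT, huA, hrq, hqT, hdisj, hq, hin, hcl⟩ := hU.exists_closed_linking hrT
    (Set.mem_insert u S) (fun x => {y | x ≠ r ∧ x ≠ w ∧ ∃ P ∈ L, x ∈ P.vertexSet ∧ y = t P}) (by
      refine fun x => Set.Subsingleton.finite ?_
      rintro _ ⟨hr, hw, P, hP, hxP, rfl⟩ _ ⟨-, -, Q, hQ, hxQ, rfl⟩
      by_contra hne
      have : x ∈ ({r, w} : Set V) :=
        hPs.2 P hP.1 Q hQ.1 (fun he => hne (he ▸ rfl)) ▸ ⟨hxP, hxQ⟩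
      exact this.elim hr hw) (by
      rintro x _ ⟨-, -, P, hP, -, rfl⟩
      exact Or.inr (htS P hP))
  have hAS : ∀ a ∈ A \ {u}, a ∈ S := fun a ha => (hAT ha.1).resolve_left ha.2
  have hqB : ∀ a ∈ A, ∀ x ∈ q a, x ∈ B → x = a := by
    intro a ha x hx hxB
    obtain ⟨p, hp⟩ := hin a ha x hx
    exact hqT a ha x hx (Or.inr (hDS p x hp hxB))
  have huB : ∀ x ∈ q u, x ∉ B := fun x hx hxB => hu (hqB u huA x hx hxB ▸ hxB)
  refine hPs.union_lastEdge_mem_GSet (K := {P ∈ L | t P ∈ A}) (A := A \ {u}) (B := B)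
    (t := t) hDG hrw ?_ (fun hh => huB w hh hw.1) (fun a ha => hqB a ha.1) huB
    (fun a ha => hq a ha.1) (hq u huA) (fun a ha b hb => hdisj a ha.1 b hb.1)
    (fun a ha x hx => hdisj a ha.1 u huA ha.2 x hx) ?_ (fun P hP => htP P hP.1)
    (fun hh => hrB (hAS r hh).1) (fun hh => hw.2 (hAS w hh)) (fun P hP => ht P hP.1) ?_
  · exact fun a ha hh => hw.2 (hqB a ha.1 w hh hw.1 ▸ hAS a ha)
  · exact fun P hP => ⟨hP.2, fun he => hu ((Set.mem_singleton_iff.1 he) ▸ (htS P hP.1).1)⟩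
  · intro P hP hPK x hx hxr hxw
    have hxq : P ∈ L → ∀ a ∈ A, x ∉ q a := fun hPL a ha hxa =>
      hPK ⟨hPL, hcl a ha x hxa ⟨hxr, hxw, P, hPL, hx, rfl⟩⟩
    by_cases hPL : P ∈ L
    · exact ⟨hxq hPL u huA, fun a ha hh => absurd hh (hxq hPL a ha.1)⟩
    · have hxB : x ∈ B := by
        by_contra hxB
        exact hPL ⟨hP, fun hh => hxB (hh x hx hxr)⟩
      exact ⟨fun hh => huB x hh hxB, fun _ _ _ => hxB⟩

end FlamePaper
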